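/- arXiv:1302.2043 — 2 statements merged into one kernel-verified Lean document; each statement's English description precedes it below -/
import Mathlib

section
/- Fix integers ℓ ≥ 1 and k ≥ 1 and θ ∈ ℂ^{2ℓ+1}, and let M^k_θ := { Σ_{i=1}^k w_i γ_{θ•φ_i} : φ_i ∈ [0,1], w_i ≥ 0, Σ_{i=1}^k w_i = 1 } be the set of k-point location mixtures of standard complex Gaussians on ℂ^{2ℓ+1}. There exist universal constants C > 0 and ε₀ ∈ (0,1) such that for every ε ∈ (0, ε₀], every k ≥ 1, every ℓ ≥ 1 and every θ ∈ ℂ^{2ℓ+1}, the ε-bracketing number N_[](ε, M^k_θ, d_H) of M^k_θ for the Hellinger distance satisfies log N_[](ε, M^k_θ, d_H) ≤ C k ( log(ℓ+1) + log(e + ‖θ‖_{H1}) + log(1/ε) ). -/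
open MeasureTheory Real Set

/-- squared Euclidean (Hermitian) norm on ℂ^p -/
noncomputable def sqnorm (p : ℕ) (z : Fin p → ℂ) : ℝ := ∑ i, ‖z i‖ ^ 2

/-- density of the standard complex Gaussian on ℂ^p centered at μ,
with respect to Lebesgue measure on ℂ^p ≃ ℝ^{2p} -/
noncomputable def cgauss (p : ℕ) (μ z : Fin p → ℂ) : ℝ :=
  (Real.pi ^ p)⁻¹ * Real.exp (-sqnorm p (z - μ))

/-- the rotated vector θ•φ, coordinates indexed by k = i - ℓ ∈ {-ℓ,…,ℓ} -/
noncomputable def rot (ℓ : ℕ) (θ : Fin (2 * ℓ + 1) → ℂ) (φ : ℝ) : Fin (2 * ℓ + 1) → ℂ :=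
  fun i => θ i * Complex.exp (-Complex.I * (2 * Real.pi * (((i : ℤ) - (ℓ : ℤ) : ℤ) : ℝ) * φ))

/-- the H1 norm ‖θ‖_{H1} = (Σ_k k²|θ_k|²)^{1/2} -/
noncomputable def H1norm (ℓ : ℕ) (θ : Fin (2 * ℓ + 1) → ℂ) : ℝ :=
  Real.sqrt (∑ i : Fin (2 * ℓ + 1), ((((i : ℤ) - (ℓ : ℤ) : ℤ) : ℝ)) ^ 2 * ‖θ i‖ ^ 2)

/-- Hellinger distance between two (densities of) finite measures on ℂ^p -/
noncomputable def dHfin (p : ℕ) (q₁ q₂ : (Fin p → ℂ) → ℝ) : ℝ :=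
  Real.sqrt (∫ z, (Real.sqrt (q₁ z) - Real.sqrt (q₂ z)) ^ 2)

theorem sqnorm_nonneg (p : ℕ) (z : Fin p → ℂ) : 0 ≤ sqnorm p z :=
  Finset.sum_nonneg fun _ _ => by positivity

theorem sqnorm_sub_comm (p : ℕ) (x y : Fin p → ℂ) : sqnorm p (x - y) = sqnorm p (y - x) := by
  simp only [sqnorm, Pi.sub_apply, norm_sub_rev]

theorem add_sq_le_weighted {t : ℝ} (ht : 0 < t) (a b : ℝ) :
    (a + b) ^ 2 ≤ (1 + t) * a ^ 2 + (1 + t⁻¹) * b ^ 2 := by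
  have h : 0 ≤ t⁻¹ * (t * a - b) ^ 2 := by positivity
  have e : t⁻¹ * (t * a - b) ^ 2 = t * a ^ 2 - 2 * a * b + t⁻¹ * b ^ 2 := by
    field_simp
    ring
  nlinarith

theorem sqnorm_sub_le {p : ℕ} {t : ℝ} (ht : 0 < t) (z μ ν : Fin p → ℂ)
    (h : sqnorm p (μ - ν) ≤ t ^ 2) :
    sqnorm p (z - ν) ≤ (1 + t) * sqnorm p (z - μ) + (t + t ^ 2) := by
  have h1 : sqnorm p (z - ν) ≤ (1 + t) * sqnorm p (z - μ) + (1 + t⁻¹) * sqnorm p (μ - ν) := by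
    simp only [sqnorm, Finset.mul_sum, ← Finset.sum_add_distrib, Pi.sub_apply]
    refine Finset.sum_le_sum fun i _ => ?_
    refine le_trans ?_ (add_sq_le_weighted ht ‖z i - μ i‖ ‖μ i - ν i‖)
    have := norm_sub_le_norm_sub_add_norm_sub (z i) (μ i) (ν i)
    gcongr
  have h2 : (1 + t⁻¹) * sqnorm p (μ - ν) ≤ (1 + t⁻¹) * t ^ 2 := by gcongr
  have h3 : (1 + t⁻¹) * t ^ 2 = t + t ^ 2 := by field_simp; ring
  linarith

theorem integral_exp_neg_mul_sqnorm_sub (p : ℕ) {b : ℝ} (hb : 0 < b) (μ : Fin p → ℂ) :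
    ∫ z, rexp (-b * sqnorm p (z - μ)) = (π / b) ^ p := by
  rw [integral_sub_right_eq_self (fun z => rexp (-b * sqnorm p z)) μ]
  have h1 : ∫ x : ℂ, rexp (-b * ‖x‖ ^ 2) = π / b := by
    have := Complex.integral_exp_neg_mul_rpow (p := 2) (by norm_num) hb
    norm_num [Real.rpow_neg_one] at this
    simpa [div_eq_mul_inv] using this
  have h2 : ∀ z : Fin p → ℂ, rexp (-b * sqnorm p z) = ∏ i, rexp (-b * ‖z i‖ ^ 2) := fun z => by
    rw [← Real.exp_sum, sqnorm, Finset.mul_sum]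
  simp_rw [h2]
  rw [integral_fintype_prod_volume_eq_prod (fun _ : Fin p => fun x : ℂ => rexp (-b * ‖x‖ ^ 2))]
  simp only [h1, Finset.prod_const, Finset.card_univ, Fintype.card_fin]

theorem integrable_exp_neg_mul_sqnorm_sub (p : ℕ) {b : ℝ} (hb : 0 < b) (μ : Fin p → ℂ) :
    Integrable fun z => rexp (-b * sqnorm p (z - μ)) := by
  by_contra h
  have h1 := integral_exp_neg_mul_sqnorm_sub p hb μ
  rw [integral_undef h] at h1
  have : 0 < (π / b) ^ p := by positivity
  linarith

/-- Lower envelope of the Gaussian densities centered at distance at most `t` from `μ`. -/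
noncomputable def gaussLower (p : ℕ) (t : ℝ) (μ z : Fin p → ℂ) : ℝ :=
  (π ^ p)⁻¹ * rexp (-(t + t ^ 2)) * rexp (-(1 + t) * sqnorm p (z - μ))

/-- Upper envelope of the Gaussian densities centered at distance at most `t` from `μ`. -/
noncomputable def gaussUpper (p : ℕ) (t : ℝ) (μ z : Fin p → ℂ) : ℝ :=
  (π ^ p)⁻¹ * rexp t * rexp (-(1 + t)⁻¹ * sqnorm p (z - μ))

theorem gaussLower_nonneg (p : ℕ) (t : ℝ) (μ z : Fin p → ℂ) : 0 ≤ gaussLower p t μ z := by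
  unfold gaussLower; positivity

theorem gaussUpper_nonneg (p : ℕ) (t : ℝ) (μ z : Fin p → ℂ) : 0 ≤ gaussUpper p t μ z := by
  unfold gaussUpper; positivity

theorem gaussLower_le_cgauss {p : ℕ} {t : ℝ} (ht : 0 < t) (μ ν z : Fin p → ℂ)
    (h : sqnorm p (μ - ν) ≤ t ^ 2) : gaussLower p t μ z ≤ cgauss p ν z := by
  have h1 := sqnorm_sub_le ht z μ ν h
  unfold gaussLower cgauss
  rw [mul_assoc, ← Real.exp_add]
  gcongr
  linarith

theorem cgauss_le_gaussUpper {p : ℕ} {t : ℝ} (ht : 0 < t) (μ ν z : Fin p → ℂ)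
    (h : sqnorm p (μ - ν) ≤ t ^ 2) : cgauss p ν z ≤ gaussUpper p t μ z := by
  have h1 := sqnorm_sub_le ht z ν μ (by rwa [sqnorm_sub_comm])
  unfold gaussUpper cgauss
  rw [mul_assoc, ← Real.exp_add]
  gcongr
  have h2 : (1 + t)⁻¹ * sqnorm p (z - μ) ≤
      (1 + t)⁻¹ * ((1 + t) * sqnorm p (z - ν) + (t + t ^ 2)) := by gcongr
  have h3 : (1 + t)⁻¹ * ((1 + t) * sqnorm p (z - ν) + (t + t ^ 2)) = sqnorm p (z - ν) + t := by
    field_simp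
  linarith

theorem gaussLower_le_gaussUpper {p : ℕ} {t : ℝ} (ht : 0 < t) (μ z : Fin p → ℂ) :
    gaussLower p t μ z ≤ gaussUpper p t μ z := by
  have h : sqnorm p (μ - μ) ≤ t ^ 2 := by simp [sqnorm]; positivity
  exact (gaussLower_le_cgauss ht μ μ z h).trans (cgauss_le_gaussUpper ht μ μ z h)

theorem integrable_gaussLower (p : ℕ) {t : ℝ} (ht : 0 < t) (μ : Fin p → ℂ) :
    Integrable (gaussLower p t μ) :=
  (integrable_exp_neg_mul_sqnorm_sub p (by positivity) μ).const_mul _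

theorem integrable_gaussUpper (p : ℕ) {t : ℝ} (ht : 0 < t) (μ : Fin p → ℂ) :
    Integrable (gaussUpper p t μ) :=
  (integrable_exp_neg_mul_sqnorm_sub p (by positivity) μ).const_mul _

theorem one_add_pow_le_exp (p : ℕ) {t : ℝ} (ht : 0 < t) : (1 + t) ^ p ≤ rexp (p * t) := by
  rw [Real.exp_nat_mul]
  have := Real.add_one_le_exp t
  gcongr
  linarith

theorem integral_gaussUpper_le (p : ℕ) {t : ℝ} (ht : 0 < t) (μ : Fin p → ℂ) :
    ∫ z, gaussUpper p t μ z ≤ rexp (p * t + t) := by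
  unfold gaussUpper
  rw [integral_const_mul, integral_exp_neg_mul_sqnorm_sub p (by positivity) μ, Real.exp_add]
  have e : (π ^ p)⁻¹ * rexp t * (π / (1 + t)⁻¹) ^ p = (1 + t) ^ p * rexp t := by
    rw [div_inv_eq_mul, mul_pow]
    field_simp
  rw [e]
  have := one_add_pow_le_exp p ht
  gcongr

theorem le_integral_gaussLower (p : ℕ) {t : ℝ} (ht : 0 < t) (μ : Fin p → ℂ) :
    rexp (-(p * t + t + t ^ 2)) ≤ ∫ z, gaussLower p t μ z := by
  unfold gaussLower
  rw [integral_const_mul, integral_exp_neg_mul_sqnorm_sub p (by positivity) μ]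
  have e : (π ^ p)⁻¹ * rexp (-(t + t ^ 2)) * (π / (1 + t)) ^ p
      = ((1 + t) ^ p)⁻¹ * rexp (-(t + t ^ 2)) := by
    rw [div_pow]
    field_simp
  have e2 : -(p * t + t + t ^ 2) = -(p * t) + -(t + t ^ 2) := by ring
  rw [e, e2, Real.exp_add, Real.exp_neg (p * t)]
  have := one_add_pow_le_exp p ht
  gcongr

theorem norm_cexp_sub_cexp_le (x y : ℝ) :
    ‖Complex.exp (Complex.I * x) - Complex.exp (Complex.I * y)‖ ≤ |x - y| := by
  have h : Complex.exp (Complex.I * x) - Complex.exp (Complex.I * y)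
      = Complex.exp (Complex.I * y) * (Complex.exp (Complex.I * (x - y : ℝ)) - 1) := by
    rw [mul_sub, ← Complex.exp_add]
    push_cast
    ring_nf
  rw [h, norm_mul, mul_comm Complex.I (y : ℂ), Complex.norm_exp_ofReal_mul_I, one_mul]
  exact Real.norm_exp_I_mul_ofReal_sub_one_le

theorem sqnorm_rot_sub_rot_le (ℓ : ℕ) (θ : Fin (2 * ℓ + 1) → ℂ) (φ ψ : ℝ) :
    sqnorm (2 * ℓ + 1) (rot ℓ θ φ - rot ℓ θ ψ) ≤ (2 * π * H1norm ℓ θ * (φ - ψ)) ^ 2 := by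
  have hH : H1norm ℓ θ ^ 2 =
      ∑ i : Fin (2 * ℓ + 1), ((((i : ℤ) - (ℓ : ℤ) : ℤ) : ℝ)) ^ 2 * ‖θ i‖ ^ 2 :=
    Real.sq_sqrt (Finset.sum_nonneg fun _ _ => by positivity)
  rw [mul_pow, mul_pow _ (H1norm ℓ θ), hH, Finset.mul_sum, Finset.sum_mul, sqnorm]
  refine Finset.sum_le_sum fun i _ => ?_
  simp only [Pi.sub_apply, rot]
  set k : ℝ := (((i : ℤ) - (ℓ : ℤ) : ℤ) : ℝ) with hk
  have e : ∀ x : ℝ, Complex.exp (-Complex.I * (2 * π * (k : ℂ) * x))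
      = Complex.exp (Complex.I * (-(2 * π * k * x) : ℝ)) := fun x => by
    push_cast; ring_nf
  rw [e, e, ← mul_sub, norm_mul]
  have h := norm_cexp_sub_cexp_le (-(2 * π * k * φ)) (-(2 * π * k * ψ))
  calc _ ≤ (‖θ i‖ * |-(2 * π * k * φ) - -(2 * π * k * ψ)|) ^ 2 := by gcongr
    _ = _ := by rw [mul_pow, sq_abs]; ring

theorem dHfin_le_of_integral_sub_le {p : ℕ} {l u : (Fin p → ℂ) → ℝ} {ε : ℝ} (hε : 0 ≤ ε)
    (hl : ∀ z, 0 ≤ l z) (hlu : ∀ z, l z ≤ u z) (il : Integrable l) (iu : Integrable u)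
    (h : (∫ z, u z) - ∫ z, l z ≤ ε ^ 2) : dHfin p l u ≤ ε := by
  unfold dHfin
  rw [Real.sqrt_le_left hε]
  refine le_trans ?_ h
  rw [← integral_sub iu il]
  refine integral_mono_of_nonneg (.of_forall fun z => sq_nonneg _) (iu.sub il)
    (.of_forall fun z => ?_)
  have h1 := Real.sqrt_le_sqrt (hlu z)
  have h2 := Real.sqrt_nonneg (l z)
  have h3 := Real.sq_sqrt (hl z)
  have h4 := Real.sq_sqrt ((hl z).trans (hlu z))
  simp only
  nlinarith

/-- The number of `n : Fin k → ℕ` with `∑ n ≤ k * A` is at most `(e * (A + 1)) ^ k`. -/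
theorem card_sum_le_mul_le (k A : ℕ) (hA : 1 ≤ A) :
    (Fintype.card {n : Fin k → Fin (k * A + 1) // ∑ j, (n j : ℕ) ≤ k * A} : ℝ)
      ≤ (rexp 1 * (A + 1)) ^ k := by
  have hA' : (0 : ℝ) < A := by exact_mod_cast hA
  set x : ℝ := A / (A + 1) with hx
  have hx0 : 0 < x := by positivity
  have hx1 : x < 1 := by rw [hx, div_lt_one (by positivity)]; linarith
  rw [Fintype.card_subtype]
  set S := Finset.univ.filter fun n : Fin k → Fin (k * A + 1) => ∑ j, (n j : ℕ) ≤ k * A with hS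
  have h1 : (S.card : ℝ) * x ^ (k * A) ≤ ∑ n : Fin k → Fin (k * A + 1), ∏ j, x ^ (n j : ℕ) := by
    rw [← nsmul_eq_mul]
    refine le_trans (Finset.card_nsmul_le_sum S (fun n => ∏ j, x ^ (n j : ℕ)) _ fun n hn => ?_)
      (Finset.sum_le_sum_of_subset_of_nonneg (Finset.subset_univ _) fun n _ _ => by positivity)
    rw [Finset.prod_pow_eq_pow_sum]
    exact pow_le_pow_of_le_one hx0.le hx1.le (by simpa [hS] using hn)
  have h2 : ∑ n : Fin k → Fin (k * A + 1), ∏ j, x ^ (n j : ℕ)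
      = (∑ m : Fin (k * A + 1), x ^ (m : ℕ)) ^ k := by
    rw [← Fintype.piFinset_univ, ← Finset.prod_univ_sum (fun _ : Fin k => Finset.univ)
      (fun _ (m : Fin (k * A + 1)) => x ^ (m : ℕ))]
    simp
  have h3 : ∑ m : Fin (k * A + 1), x ^ (m : ℕ) ≤ A + 1 := by
    rw [Fin.sum_univ_eq_sum_range (fun m => x ^ m)]
    refine le_trans (Summable.sum_le_tsum _ (fun _ _ => by positivity)
      (summable_geometric_of_lt_one hx0.le hx1)) ?_
    rw [tsum_geometric_of_lt_one hx0.le hx1, hx]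
    apply le_of_eq
    field_simp
    ring
  have h4 : x⁻¹ ^ A ≤ rexp 1 := by
    have e : x⁻¹ = 1 + (A : ℝ)⁻¹ := by rw [hx]; field_simp
    rw [e]
    refine (one_add_pow_le_exp A (by positivity)).trans (le_of_eq ?_)
    rw [mul_inv_cancel₀ hA'.ne']
  calc (S.card : ℝ) = (S.card : ℝ) * x ^ (k * A) * (x⁻¹ ^ A) ^ k := by
        rw [← pow_mul, mul_comm A k, inv_pow, mul_assoc, mul_inv_cancel₀ (by positivity), mul_one]
    _ ≤ (∑ m : Fin (k * A + 1), x ^ (m : ℕ)) ^ k * rexp 1 ^ k := by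
        rw [← h2]; gcongr
    _ ≤ (A + 1) ^ k * rexp 1 ^ k := by gcongr
    _ = _ := by rw [mul_comm, mul_pow]

theorem integral_sum_const_mul {p k : ℕ} (c : Fin k → ℝ) (f : Fin k → (Fin p → ℂ) → ℝ)
    (hf : ∀ j, Integrable (f j)) :
    ∫ z, ∑ j, c j * f j z = ∑ j, c j * ∫ z, f j z := by
  rw [integral_finsetSum _ fun j _ => (hf j).const_mul _]
  simp_rw [integral_const_mul]

theorem exp_sub_exp_add_mul_exp_le {a : ℝ} (ha : 0 < a) (ha' : a ≤ 1 / 10) :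
    rexp (2 * a) - rexp (-(3 * a)) + a * rexp (2 * a) ≤ 10 * a := by
  have h1 : rexp (2 * a) ≤ 1 + 4 * a := by
    have h := Real.add_one_le_exp (-(2 * a))
    rw [Real.exp_neg] at h
    have h' : rexp (2 * a) * (-(2 * a) + 1) ≤ 1 := by
      have := mul_le_mul_of_nonneg_left h (Real.exp_pos (2 * a)).le
      rwa [mul_inv_cancel₀ (Real.exp_pos _).ne'] at this
    nlinarith [Real.exp_pos (2 * a)]
  have h2 := Real.add_one_le_exp (-(3 * a))
  nlinarith

/-- The weighted Gaussian envelopes with centers `μ` and weights `n j / M`, `(n j + 1) / M`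
bracket in Hellinger distance. -/
theorem dHfin_mixture_envelopes_le {p k A : ℕ} (hp : 1 ≤ p) (hk : 1 ≤ k) {a ε : ℝ} (hε : 0 ≤ ε)
    (ha : 0 < a) (ha' : a ≤ 1 / 10) (haε : 10 * a ≤ ε ^ 2) (hA : a⁻¹ ≤ A)
    (μ : Fin k → Fin p → ℂ) (n : Fin k → ℕ) (hn : ∑ j, n j ≤ k * A) :
    dHfin p (fun z => ∑ j, (n j / (k * A) : ℝ) * gaussLower p (a / p) (μ j) z)
      (fun z => ∑ j, ((n j + 1) / (k * A) : ℝ) * gaussUpper p (a / p) (μ j) z) ≤ ε := by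
  have hp' : (1 : ℝ) ≤ p := by exact_mod_cast hp
  have hk' : (0 : ℝ) < k := by exact_mod_cast hk
  have hA' : (0 : ℝ) < A := lt_of_lt_of_le (by positivity) hA
  have ht : 0 < a / p := by positivity
  have hta : a / p ≤ a := div_le_self ha.le hp'
  have hpt : p * (a / p) = a := by field_simp
  have ht2 : (a / p) ^ 2 ≤ a := by nlinarith
  refine dHfin_le_of_integral_sub_le hε
    (fun z => Finset.sum_nonneg fun j _ => mul_nonneg (by positivity) (gaussLower_nonneg ..))
    (fun z => Finset.sum_le_sum fun j _ => ?_)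
    (integrable_finsetSum _ fun j _ => (integrable_gaussLower p ht (μ j)).const_mul _)
    (integrable_finsetSum _ fun j _ => (integrable_gaussUpper p ht (μ j)).const_mul _) ?_
  · have := gaussLower_le_gaussUpper ht (μ j) z
    have := gaussLower_nonneg p (a / p) (μ j) z
    gcongr
    linarith
  · rw [integral_sum_const_mul _ _ fun j => integrable_gaussLower p ht (μ j),
      integral_sum_const_mul _ _ fun j => integrable_gaussUpper p ht (μ j),
      ← Finset.sum_sub_distrib]
    have hU : ∀ j, ∫ z, gaussUpper p (a / p) (μ j) z ≤ rexp (2 * a) := fun j =>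
      (integral_gaussUpper_le p ht (μ j)).trans (Real.exp_le_exp.2 (by linarith))
    have hL : ∀ j, rexp (-(3 * a)) ≤ ∫ z, gaussLower p (a / p) (μ j) z := fun j =>
      le_trans (Real.exp_le_exp.2 (by linarith)) (le_integral_gaussLower p ht (μ j))
    have hn' : (∑ j, (n j : ℝ)) ≤ k * A := by exact_mod_cast hn
    have hgap : 0 ≤ rexp (2 * a) - rexp (-(3 * a)) :=
      sub_nonneg.2 (Real.exp_le_exp.2 (by linarith))
    calc _ ≤ ∑ j, ((n j + 1) / (k * A) * rexp (2 * a) - n j / (k * A) * rexp (-(3 * a))) := by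
          refine Finset.sum_le_sum fun j _ => ?_
          have := hU j
          have := hL j
          gcongr
      _ = (∑ j, (n j : ℝ)) / (k * A) * (rexp (2 * a) - rexp (-(3 * a)))
            + (A : ℝ)⁻¹ * rexp (2 * a) := by
          have : ∀ j, ((n j + 1) / (k * A) * rexp (2 * a) - n j / (k * A) * rexp (-(3 * a)))
              = n j * ((rexp (2 * a) - rexp (-(3 * a))) / (k * A)) + rexp (2 * a) / (k * A) :=
            fun j => by ring
          simp_rw [this]
          rw [Finset.sum_add_distrib, ← Finset.sum_mul, Finset.sum_const, Finset.card_univ,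
            Fintype.card_fin, nsmul_eq_mul]
          field_simp
      _ ≤ 1 * (rexp (2 * a) - rexp (-(3 * a))) + a * rexp (2 * a) := by
          gcongr
          · exact div_le_one_of_le₀ hn' (by positivity)
          · exact inv_le_of_inv_le₀ ha hA
      _ ≤ ε ^ 2 := by
          have := exp_sub_exp_add_mul_exp_le ha ha'
          linarith

theorem abs_sub_floor_div_le {m : ℕ} (hm : 1 ≤ m) {x : ℝ} (hx : 0 ≤ x) :
    |(⌊m * x⌋₊ / m : ℝ) - x| ≤ 1 / m := by
  have hm' : (0 : ℝ) < m := by exact_mod_cast hm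
  have h1 := Nat.floor_le (a := m * x) (by positivity)
  have h2 := Nat.lt_floor_add_one (m * x)
  have e : (⌊m * x⌋₊ / m : ℝ) - x = (⌊m * x⌋₊ - m * x) / m := by field_simp
  rw [e, abs_div, abs_of_pos hm']
  gcongr
  rw [abs_le]
  constructor <;> linarith

/-- Numerical bound on the logarithm of the size of the discretization. -/
theorem log_card_le {ε H : ℝ} (hε : 0 < ε) (hε' : ε ≤ 1 / 2) (hH : 0 ≤ H) (ℓ : ℕ) {m A : ℝ}
    (hm0 : 0 ≤ m) (hA0 : 0 ≤ A)
    (hm : m ≤ 7 * H * (2 * ℓ + 1) / (ε ^ 2 / 10) + 2) (hA : A ≤ (ε ^ 2 / 10)⁻¹ + 1) :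
    log ((m + 1) * (rexp 1 * (A + 1)))
      ≤ 20 * (log (ℓ + 1) + log (rexp 1 + H) + log (1 / ε)) := by
  have hE := Real.exp_one_gt_d9
  have hE' := Real.exp_one_lt_d9
  have hinv : 1 ≤ 1 / ε ^ 2 := by
    rw [le_div_iff₀ (by positivity)]; nlinarith
  have hℓ : (0 : ℝ) ≤ ℓ := by positivity
  have hmX : m + 1 ≤ 150 * ((ℓ + 1) * (rexp 1 + H) * (1 / ε) ^ 2) := by
    have e : 7 * H * (2 * ℓ + 1) / (ε ^ 2 / 10) = 70 * H * (2 * ℓ + 1) * (1 / ε ^ 2) := by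
      field_simp; ring
    rw [e] at hm
    rw [one_div_pow]
    have h1 : 70 * H * (2 * ℓ + 1) + 3 ≤ 150 * ((ℓ + 1) * (rexp 1 + H)) := by
      nlinarith [mul_nonneg hℓ hH, mul_nonneg hℓ (Real.exp_pos 1).le]
    nlinarith
  have hAX : rexp 1 * (A + 1) ≤ 36 * (1 / ε) ^ 2 := by
    have e : (ε ^ 2 / 10)⁻¹ = 10 * (1 / ε ^ 2) := by field_simp
    rw [e] at hA
    rw [one_div_pow]
    nlinarith
  have hX : (m + 1) * (rexp 1 * (A + 1))
      ≤ rexp 1 ^ 10 * ((ℓ + 1) * (rexp 1 + H) * (1 / ε) ^ 4) := by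
    calc _ ≤ (150 * ((ℓ + 1) * (rexp 1 + H) * (1 / ε) ^ 2)) * (36 * (1 / ε) ^ 2) := by gcongr
      _ = 5400 * ((ℓ + 1) * (rexp 1 + H) * (1 / ε) ^ 4) := by ring
      _ ≤ _ := by
          gcongr
          calc (5400 : ℝ) ≤ 2.7 ^ 10 := by norm_num
            _ ≤ _ := by gcongr; linarith
  refine (Real.log_le_log (by positivity) hX).trans ?_
  have hH' : 0 < rexp 1 + H := by positivity
  rw [Real.log_mul (by positivity) (by positivity), Real.log_mul (by positivity) (by positivity),
    Real.log_mul (by positivity) (by positivity), Real.log_pow, Real.log_pow, Real.log_exp]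
  have l1 : 0 ≤ log ((ℓ : ℝ) + 1) := Real.log_nonneg (by linarith)
  have l2 : 1 ≤ log (rexp 1 + H) := by
    rw [Real.le_log_iff_exp_le hH']; linarith
  have l3 : 0 ≤ log (1 / ε) := Real.log_nonneg (by rw [le_div_iff₀ hε]; linarith)
  push_cast
  linarith

/-- Hellinger ε-bracketing number of the class M^k_θ of k-point location
mixtures of standard complex Gaussians on ℂ^{2ℓ+1}:
log N_[](ε, M^k_θ, d_H) ≤ C k (log(ℓ+1) + log(e+‖θ‖_{H1}) + log(1/ε)). -/
theorem bracketing_of_finite_mixtures :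
    ∃ C : ℝ, 0 < C ∧ ∃ ε₀ ∈ Set.Ioo (0 : ℝ) 1, ∀ ε ∈ Set.Ioc (0 : ℝ) ε₀,
      ∀ (k ℓ : ℕ), 1 ≤ k → 1 ≤ ℓ → ∀ θ : Fin (2 * ℓ + 1) → ℂ,
        ∃ N : ℕ, 1 ≤ N ∧
          Real.log N ≤ C * (k : ℝ) * (Real.log ((ℓ : ℝ) + 1)
            + Real.log (Real.exp 1 + H1norm ℓ θ) + Real.log (1 / ε)) ∧
          ∃ l u : Fin N → (Fin (2 * ℓ + 1) → ℂ) → ℝ,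
            (∀ i, (∀ z, 0 ≤ l i z) ∧ (∀ z, 0 ≤ u i z) ∧
              Integrable (l i) ∧ Integrable (u i) ∧
              dHfin (2 * ℓ + 1) (l i) (u i) ≤ ε) ∧
            (∀ (w : Fin k → ℝ) (φ : Fin k → ℝ),
              (∀ j, 0 ≤ w j) → (∀ j, φ j ∈ Set.Icc (0 : ℝ) 1) → (∑ j, w j) = 1 →
              ∃ i, ∀ z,
                l i z ≤ ∑ j, w j * cgauss (2 * ℓ + 1) (rot ℓ θ (φ j)) z ∧
                (∑ j, w j * cgauss (2 * ℓ + 1) (rot ℓ θ (φ j)) z) ≤ u i z) := by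
  refine ⟨20, by norm_num, 1 / 2, by norm_num, ?_⟩
  rintro ε ⟨hε, hε'⟩ k ℓ hk hℓ θ
  set H := H1norm ℓ θ with hHdef
  have hH : 0 ≤ H := Real.sqrt_nonneg _
  set a : ℝ := ε ^ 2 / 10 with ha_def
  have ha : 0 < a := by positivity
  have ha' : a ≤ 1 / 10 := by rw [ha_def]; nlinarith
  set A : ℕ := ⌈a⁻¹⌉₊ with hA_def
  have hA : a⁻¹ ≤ A := Nat.le_ceil _
  have hApos : (0 : ℝ) < A := lt_of_lt_of_le (by positivity) hA
  have hA1 : 1 ≤ A := by exact_mod_cast hApos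
  set B : ℝ := 7 * H * (2 * ℓ + 1) / a with hB
  set m : ℕ := ⌈B⌉₊ + 1 with hm_def
  have hm1 : 1 ≤ m := by omega
  have hmB : B ≤ m := by
    rw [hm_def]; push_cast; linarith [Nat.le_ceil B]
  have hm0 : (0 : ℝ) < m := by exact_mod_cast hm1
  have hk0 : (0 : ℝ) < k := by exact_mod_cast hk
  let W := {n : Fin k → Fin (k * A + 1) // ∑ j, (n j : ℕ) ≤ k * A}
  let S := (Fin k → Fin (m + 1)) × W
  have : Nonempty S := ⟨fun _ => 0, fun _ => 0, by simp⟩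
  let e : Fin (Fintype.card S) ≃ S := (Fintype.equivFin S).symm
  set t : ℝ := a / (2 * ℓ + 1 : ℕ) with ht_def
  have ht : 0 < t := by positivity
  let μ : S → Fin k → Fin (2 * ℓ + 1) → ℂ := fun s j => rot ℓ θ ((s.1 j : ℕ) / m)
  let L : S → (Fin (2 * ℓ + 1) → ℂ) → ℝ := fun s z =>
    ∑ j, ((s.2.1 j : ℕ) / (k * A) : ℝ) * gaussLower (2 * ℓ + 1) t (μ s j) z
  let U : S → (Fin (2 * ℓ + 1) → ℂ) → ℝ := fun s z =>
    ∑ j, (((s.2.1 j : ℕ) + 1) / (k * A) : ℝ) * gaussUpper (2 * ℓ + 1) t (μ s j) z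
  refine ⟨Fintype.card S, Fintype.card_pos, ?_, fun i => L (e i), fun i => U (e i),
    fun i => ⟨fun z => ?_, fun z => ?_, ?_, ?_, ?_⟩, fun w φ hw hφ hsum => ?_⟩
  · have hcard : (Fintype.card S : ℝ) ≤ ((m + 1) * (rexp 1 * (A + 1))) ^ k := by
      have h1 : (Fintype.card S : ℝ) = (m + 1 : ℝ) ^ k * Fintype.card W := by
        simp [S]
      rw [h1, mul_pow]
      have := card_sum_le_mul_le k A hA1
      gcongr
    have hpos : (0 : ℝ) < Fintype.card S := by exact_mod_cast Fintype.card_pos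
    have h2 := Real.log_le_log hpos hcard
    rw [Real.log_pow] at h2
    have hmle : (m : ℝ) ≤ B + 2 := by
      have := Nat.ceil_lt_add_one (a := B) (by positivity)
      rw [hm_def]; push_cast; linarith
    have hAle : (A : ℝ) ≤ a⁻¹ + 1 := (Nat.ceil_lt_add_one (by positivity)).le
    have h3 := log_card_le hε hε' hH ℓ hm0.le hApos.le hmle hAle
    calc _ ≤ _ := h2
      _ ≤ k * (20 * (log (ℓ + 1) + log (rexp 1 + H) + log (1 / ε))) := by gcongr
      _ = _ := by ring
  · exact Finset.sum_nonneg fun j _ => mul_nonneg (by positivity) (gaussLower_nonneg ..)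
  · exact Finset.sum_nonneg fun j _ => mul_nonneg (by positivity) (gaussUpper_nonneg ..)
  · exact integrable_finsetSum _ fun j _ => (integrable_gaussLower _ ht _).const_mul _
  · exact integrable_finsetSum _ fun j _ => (integrable_gaussUpper _ ht _).const_mul _
  · exact dHfin_mixture_envelopes_le (by omega) hk hε.le ha ha' (by rw [ha_def]; linarith) hA
      (μ (e i)) (fun j => ((e i).2.1 j : ℕ)) (e i).2.2
  · have hw1 : ∀ j, w j ≤ 1 := fun j =>
      hsum ▸ Finset.single_le_sum (fun i _ => hw i) (Finset.mem_univ j)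
    have hfl : ∀ j, (⌊(k * A : ℕ) * w j⌋₊ : ℝ) ≤ (k * A : ℕ) * w j := fun j =>
      Nat.floor_le (mul_nonneg (by positivity) (hw j))
    have hfloor : ∀ j, ⌊(k * A : ℕ) * w j⌋₊ < k * A + 1 := fun j =>
      Nat.lt_succ_of_le (Nat.floor_le_of_le
        (mul_le_of_le_one_right (by positivity) (hw1 j)))
    have hfsum : ∑ j, ⌊(k * A : ℕ) * w j⌋₊ ≤ k * A := by
      have : ((∑ j, ⌊(k * A : ℕ) * w j⌋₊ : ℕ) : ℝ) ≤ (k * A : ℕ) := by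
        rw [Nat.cast_sum]
        refine (Finset.sum_le_sum fun j _ => hfl j).trans ?_
        rw [← Finset.mul_sum, hsum, mul_one]
      exact_mod_cast this
    have hphi : ∀ j, ⌊m * φ j⌋₊ < m + 1 := fun j =>
      Nat.lt_succ_of_le (Nat.floor_le_of_le
        (mul_le_of_le_one_right (by positivity) (hφ j).2))
    let s : S := (fun j => ⟨_, hphi j⟩, ⟨fun j => ⟨_, hfloor j⟩, hfsum⟩)
    have hclose : ∀ j, sqnorm (2 * ℓ + 1) (μ s j - rot ℓ θ (φ j)) ≤ t ^ 2 := fun j => by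
      refine (sqnorm_rot_sub_rot_le ℓ θ _ _).trans ?_
      rw [sq_le_sq, abs_of_pos ht, abs_mul, abs_of_nonneg (by positivity)]
      calc _ ≤ 2 * π * H * (1 / m) := by
            gcongr
            exact abs_sub_floor_div_le hm1 (hφ j).1
        _ ≤ 7 * H * (1 / m) := by
            gcongr
            linarith [Real.pi_lt_d2]
        _ ≤ t := by
            rw [hB, div_le_iff₀ ha] at hmB
            rw [ht_def, mul_one_div, div_le_div_iff₀ hm0 (by positivity)]
            push_cast
            linarith
    have hkA : (0 : ℝ) < k * A := by positivity
    refine ⟨e.symm s, fun z => ?_⟩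
    simp only [Equiv.apply_symm_apply]
    refine ⟨Finset.sum_le_sum fun j _ => ?_, Finset.sum_le_sum fun j _ => ?_⟩
    · refine mul_le_mul ?_ (gaussLower_le_cgauss ht _ _ z (hclose j)) (gaussLower_nonneg ..) (hw j)
      rw [div_le_iff₀ hkA, mul_comm (w j)]
      exact_mod_cast hfl j
    · refine mul_le_mul ?_ (cgauss_le_gaussUpper ht _ _ z (hclose j)) ?_ (by positivity)
      · rw [le_div_iff₀ hkA, mul_comm (w j)]
        exact_mod_cast (Nat.lt_floor_add_one ((k * A : ℕ) * w j)).le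
      · unfold cgauss; positivity
end

section
/- For every a > 0 and b > 0 there exist constants C > 0 and ε₀ ∈ (0,1) such that the following holds. Let ε ∈ (0, ε₀], let ℓ ≥ 1 be an integer with log(1/ε) ≤ b ℓ, and let θ ∈ ℂ^{2ℓ+1} satisfy ‖θ‖² ≤ a(2ℓ+1). Then there exists a finite set S of probability measures on ℂ^{2ℓ+1} with log |S| ≤ C ℓ² ( log(1/ε) + log(e + ‖θ‖_{H1}) ) such that for every Borel probability measure g on [0,1] there is Q ∈ S with d_TV(P_{θ,g}, Q) ≤ ε. In other words, log N(ε, {P_{θ,g} : g ∈ 𝔐([0,1])}, d_TV) ≤ C ℓ² ( log(1/ε) + log(e + ‖θ‖_{H1}) ). -/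
open MeasureTheory Real Set

/-- g is a Borel probability measure on [0,1] (encoded as a measure on ℝ carried by [0,1]) -/
def IsProbOn01 (g : MeasureTheory.Measure ℝ) : Prop :=
  MeasureTheory.IsProbabilityMeasure g ∧ g (Set.Icc 0 1) = 1

/-- density z ↦ ∫₀¹ γ(z − θ•φ) dg(φ) of the Gaussian mixture P_{θ,g} on ℂ^{2ℓ+1} -/
noncomputable def mixDensity (ℓ : ℕ) (θ : Fin (2 * ℓ + 1) → ℂ) (g : Measure ℝ)
    (z : Fin (2 * ℓ + 1) → ℂ) : ℝ :=
  ∫ φ, cgauss (2 * ℓ + 1) (rot ℓ θ φ) z ∂g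

/-- the Gaussian mixture measure P_{θ,g} on ℂ^{2ℓ+1} -/
noncomputable def mixMeasure (ℓ : ℕ) (θ : Fin (2 * ℓ + 1) → ℂ) (g : Measure ℝ) :
    Measure (Fin (2 * ℓ + 1) → ℂ) :=
  volume.withDensity (fun z => ENNReal.ofReal (mixDensity ℓ θ g z))

/-- total variation distance between two measures: sup over measurable sets A
of |P(A) − Q(A)| -/
noncomputable def dTV {X : Type*} [MeasurableSpace X] (P Q : Measure X) : ℝ :=
  ⨆ (A : Set X) (_ : MeasurableSet A), |(P A).toReal - (Q A).toReal|

lemma cgauss_nonneg (p : ℕ) (μ z : Fin p → ℂ) : 0 ≤ cgauss p μ z := by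
  unfold cgauss; positivity

lemma measurable_cgauss_uncurry (p : ℕ) :
    Measurable fun x : (Fin p → ℂ) × (Fin p → ℂ) => cgauss p x.1 x.2 := by
  refine Continuous.measurable ?_
  unfold cgauss sqnorm
  fun_prop

lemma integral_cgauss (p : ℕ) (μ : Fin p → ℂ) : ∫ z, cgauss p μ z = 1 := by
  have h (z : Fin p → ℂ) :
      cgauss p μ z = (fun w : Fin p → ℂ => ∏ i, (π⁻¹ * rexp (-1 * ‖w i‖ ^ 2))) (z - μ) := by
    simp only [cgauss, sqnorm, Finset.prod_mul_distrib, ← Real.exp_sum]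
    simp
  simp_rw [h]
  rw [integral_sub_right_eq_self (fun w : Fin p → ℂ => ∏ i, (π⁻¹ * rexp (-1 * ‖w i‖ ^ 2))) μ,
    integral_fintype_prod_volume_eq_prod (fun _ (w : ℂ) => π⁻¹ * rexp (-1 * ‖w‖ ^ 2))]
  have h1 : ∫ w : ℂ, π⁻¹ * rexp (-1 * ‖w‖ ^ 2) = 1 := by
    rw [integral_const_mul, GaussianFourier.integral_rexp_neg_mul_sq_norm one_pos,
      Complex.finrank_real_complex]
    norm_num
  rw [h1, Finset.prod_const_one]

lemma integrable_cgauss (p : ℕ) (μ : Fin p → ℂ) : Integrable (cgauss p μ) :=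
  Integrable.of_integral_ne_zero (by simp [integral_cgauss])

lemma exp_mul_cgauss_zero (p : ℕ) (μ z : Fin p → ℂ) (s : ℝ) :
    (π ^ p)⁻¹ * rexp (-sqnorm p z + s * (2 * ∑ i, (μ i * (starRingEnd ℂ) (z i)).re)) =
      rexp (s ^ 2 * sqnorm p μ) * cgauss p ((s : ℂ) • μ) z := by
  unfold cgauss
  rw [mul_left_comm (rexp _), ← Real.exp_add]
  congr 2
  simp only [sqnorm, Finset.mul_sum, ← Finset.sum_neg_distrib, ← Finset.sum_add_distrib]
  refine Finset.sum_congr rfl fun i _ => ?_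
  simp only [← Complex.normSq_eq_norm_sq, Complex.normSq_apply, Pi.sub_apply, Pi.smul_apply,
    Complex.sub_re, Complex.sub_im, smul_eq_mul, Complex.mul_re, Complex.mul_im,
    Complex.ofReal_re, Complex.ofReal_im, Complex.conj_re, Complex.conj_im]
  ring

lemma cgauss_sq (p : ℕ) (μ ν z : Fin p → ℂ) :
    cgauss p μ z ^ 2 =
      rexp (2 * sqnorm p (μ - ν)) * cgauss p ((2 : ℂ) • μ - ν) z * cgauss p ν z := by
  have : rexp (-sqnorm p (z - μ)) ^ 2 = rexp (2 * sqnorm p (μ - ν)) *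
      rexp (-sqnorm p (z - ((2 : ℂ) • μ - ν))) * rexp (-sqnorm p (z - ν)) := by
    rw [← Real.exp_nat_mul, ← Real.exp_add, ← Real.exp_add]
    congr 1
    simp only [sqnorm, Finset.mul_sum, ← Finset.sum_neg_distrib, ← Finset.sum_add_distrib]
    refine Finset.sum_congr rfl fun i _ => ?_
    simp only [← Complex.normSq_eq_norm_sq, Complex.normSq_apply, Pi.sub_apply, Pi.smul_apply,
      Complex.sub_re, Complex.sub_im, smul_eq_mul, Complex.mul_re, Complex.mul_im,
      Complex.re_ofNat, Complex.im_ofNat]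
    push_cast
    ring
  unfold cgauss
  rw [mul_pow, this]
  ring

lemma abs_cgauss_sub_le (p : ℕ) (μ ν z : Fin p → ℂ) {η : ℝ} (hη : 0 < η) :
    |cgauss p μ z - cgauss p ν z| ≤ η / 2 * cgauss p ν z +
      (2 * η)⁻¹ * (rexp (2 * sqnorm p (μ - ν)) * cgauss p ((2 : ℂ) • μ - ν) z
        - 2 * cgauss p μ z + cgauss p ν z) := by
  have hq : 0 < cgauss p ν z := by unfold cgauss; positivity
  have h := cgauss_sq p μ ν z
  set x := cgauss p μ z
  set q := cgauss p ν z
  set y := rexp (2 * sqnorm p (μ - ν)) * cgauss p ((2 : ℂ) • μ - ν) z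
  have hy : y - 2 * x + q = (x - q) ^ 2 / q := by
    rw [eq_div_iff hq.ne']; linear_combination -h
  rw [hy]
  have : η / 2 * q + (2 * η)⁻¹ * ((x - q) ^ 2 / q) - |x - q| =
      (η * q - |x - q|) ^ 2 / (2 * η * q) := by
    field_simp
    rw [← sq_abs (x - q)]
    ring
  have : 0 ≤ (η * q - |x - q|) ^ 2 / (2 * η * q) := by positivity
  linarith

lemma integral_abs_cgauss_sub_le (p : ℕ) (μ ν : Fin p → ℂ) {η : ℝ} (hη : 0 < η) (hη1 : η ≤ 1)
    (h : sqnorm p (μ - ν) ≤ η ^ 2 / 16) : ∫ z, |cgauss p μ z - cgauss p ν z| ≤ η := by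
  have hi := integrable_cgauss p
  have h1 : Integrable fun z => η / 2 * cgauss p ν z := (hi ν).const_mul _
  have h2 : Integrable fun z =>
      rexp (2 * sqnorm p (μ - ν)) * cgauss p ((2 : ℂ) • μ - ν) z := (hi _).const_mul _
  have h3 : Integrable fun z => 2 * cgauss p μ z := (hi μ).const_mul _
  have h4 : Integrable fun z => rexp (2 * sqnorm p (μ - ν)) * cgauss p ((2 : ℂ) • μ - ν) z
        - 2 * cgauss p μ z := h2.sub h3
  have h5 : Integrable fun z => rexp (2 * sqnorm p (μ - ν)) * cgauss p ((2 : ℂ) • μ - ν) z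
        - 2 * cgauss p μ z + cgauss p ν z := h4.add (hi ν)
  calc ∫ z, |cgauss p μ z - cgauss p ν z|
      ≤ ∫ z, (η / 2 * cgauss p ν z +
      (2 * η)⁻¹ * (rexp (2 * sqnorm p (μ - ν)) * cgauss p ((2 : ℂ) • μ - ν) z
        - 2 * cgauss p μ z + cgauss p ν z)) :=
        integral_mono ((hi μ).sub (hi ν)).abs
          (h1.add (h5.const_mul _)) fun z => abs_cgauss_sub_le p μ ν z hη
    _ = η / 2 + (2 * η)⁻¹ * (rexp (2 * sqnorm p (μ - ν)) - 1) := by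
        rw [integral_add h1 (h5.const_mul _), integral_const_mul, integral_const_mul,
          integral_add h4 (hi ν), integral_sub h2 h3, integral_const_mul, integral_const_mul]
        simp only [integral_cgauss]
        ring
    _ ≤ η / 2 + (2 * η)⁻¹ * η ^ 2 := by
        have h0 : 0 ≤ sqnorm p (μ - ν) := by unfold sqnorm; positivity
        have : rexp (2 * sqnorm p (μ - ν)) - 1 ≤ η ^ 2 := by
          have := Real.abs_exp_sub_one_le (x := 2 * sqnorm p (μ - ν))
            (by rw [abs_of_nonneg (by positivity)]; nlinarith)
          rw [abs_of_nonneg (a := 2 * sqnorm p (μ - ν)) (by positivity)] at this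
          nlinarith [le_abs_self (rexp (2 * sqnorm p (μ - ν)) - 1)]
        gcongr
    _ = η := by field_simp; ring

lemma Real.abs_exp_sub_sum_le {s : ℝ} (hs : 1 ≤ s) (J : ℕ) (t : ℝ) :
    |rexp t - ∑ j ∈ Finset.range J, t ^ j / j.factorial| ≤
      (s ^ J)⁻¹ * (rexp (s * t) + rexp (-s * t)) := by
  have key (x : ℝ) (hx : 0 ≤ x) :
      rexp x - ∑ j ∈ Finset.range J, x ^ j / j.factorial ≤ (s ^ J)⁻¹ * rexp (s * x) := by
    have e (y : ℝ) : rexp y = ∑' n : ℕ, y ^ n / n.factorial := by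
      rw [Real.exp_eq_exp_ℝ, NormedSpace.exp_eq_tsum_div]
    have hS := Real.summable_pow_div_factorial
    have h1 := (hS x).sum_add_tsum_nat_add J
    have h2 := (hS (s * x)).sum_add_tsum_nat_add J
    have h3 : 0 ≤ ∑ j ∈ Finset.range J, (s * x) ^ j / j.factorial := by positivity
    have h4 : ∑' n, x ^ (n + J) / (n + J).factorial ≤
        ∑' n, (s ^ J)⁻¹ * ((s * x) ^ (n + J) / (n + J).factorial) := by
      refine Summable.tsum_le_tsum (fun n => ?_) ((summable_nat_add_iff J).2 (hS x))
        (((summable_nat_add_iff J).2 (hS (s * x))).mul_left _)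
      have : (s ^ J)⁻¹ * ((s * x) ^ (n + J) / (n + J).factorial)
          = s ^ n * (x ^ (n + J) / (n + J).factorial) := by
        rw [mul_pow, pow_add s n J]; field_simp
      rw [this]
      exact le_mul_of_one_le_left (by positivity) (one_le_pow₀ hs)
    rw [tsum_mul_left] at h4
    rw [e x, e (s * x)]
    calc _ = ∑' n, x ^ (n + J) / (n + J).factorial := by rw [← h1]; ring
      _ ≤ _ := h4
      _ ≤ _ := mul_le_mul_of_nonneg_left (by rw [← h2]; linarith) (by positivity)
  have h1 := Complex.norm_exp_sub_sum_le_exp_norm_sub_sum (t : ℂ) J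
  have h2 : ‖Complex.exp t - ∑ j ∈ Finset.range J, (t : ℂ) ^ j / j.factorial‖ =
      |rexp t - ∑ j ∈ Finset.range J, t ^ j / j.factorial| := by
    rw [← Real.norm_eq_abs, ← Complex.norm_real]; push_cast; rfl
  rw [h2, Complex.norm_real, Real.norm_eq_abs] at h1
  refine (h1.trans (key |t| (abs_nonneg t))).trans ?_
  gcongr
  rcases abs_cases t with ⟨h, _⟩ | ⟨h, _⟩ <;> rw [h]
  · linarith [Real.exp_pos (-s * t)]
  · rw [mul_neg, neg_mul]; linarith [Real.exp_pos (s * t)]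

lemma sqnorm_rot (ℓ : ℕ) (θ : Fin (2 * ℓ + 1) → ℂ) (φ : ℝ) :
    sqnorm (2 * ℓ + 1) (rot ℓ θ φ) = sqnorm (2 * ℓ + 1) θ := by
  unfold sqnorm rot
  refine Finset.sum_congr rfl fun i _ => ?_
  rw [norm_mul, Complex.norm_exp]
  simp

/-- The trigonometric moment vector `(e^{2πinφ})_{-D ≤ n ≤ D}`, indexed from `0`. -/
noncomputable def trigMoment (D : ℕ) (φ : ℝ) : Fin (2 * D + 1) → ℂ :=
  fun n => (Complex.exp (2 * π * Complex.I * φ))⁻¹ ^ D *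
    Complex.exp (2 * π * Complex.I * φ) ^ (n : ℕ)

lemma sum_mul_eval_eq_zero {ι : Type*} [Fintype ι] {D : ℕ} {ν φ : ι → ℝ}
    (h : ∑ i, ν i • trigMoment D (φ i) = 0) (Q : Polynomial ℂ) (hQ : Q.natDegree ≤ 2 * D) :
    ∑ i, (ν i : ℂ) * ((Complex.exp (2 * π * Complex.I * φ i))⁻¹ ^ D *
      Q.eval (Complex.exp (2 * π * Complex.I * φ i))) = 0 := by
  have hn (n : ℕ) (hn : n < 2 * D + 1) : ∑ i, (ν i : ℂ) *
      ((Complex.exp (2 * π * Complex.I * φ i))⁻¹ ^ D *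
        Complex.exp (2 * π * Complex.I * φ i) ^ n) = 0 := by
    simpa [trigMoment, Finset.sum_apply] using congrFun h ⟨n, hn⟩
  calc _ = ∑ n ∈ Finset.range (2 * D + 1), Q.coeff n * ∑ i, (ν i : ℂ) *
      ((Complex.exp (2 * π * Complex.I * φ i))⁻¹ ^ D *
        Complex.exp (2 * π * Complex.I * φ i) ^ n) := by
        simp_rw [Polynomial.eval_eq_sum_range' (Nat.lt_succ_of_le hQ), Finset.mul_sum]
        rw [Finset.sum_comm]
        refine Finset.sum_congr rfl fun n _ => Finset.sum_congr rfl fun i _ => ?_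
        ring
    _ = 0 := Finset.sum_eq_zero fun n h => by rw [hn n (Finset.mem_range.1 h), mul_zero]

/-- The exponent `2 Re ⟨z, θ•φ⟩`. -/
noncomputable def rotPairing (ℓ : ℕ) (θ z : Fin (2 * ℓ + 1) → ℂ) (φ : ℝ) : ℝ :=
  2 * ∑ i, (rot ℓ θ φ i * (starRingEnd ℂ) (z i)).re

/-- The polynomial in `e^{2πiφ}` representing `e^{2πiℓφ} · 2 Re ⟨z, θ•φ⟩`. -/
noncomputable def rotPoly (ℓ : ℕ) (θ z : Fin (2 * ℓ + 1) → ℂ) : Polynomial ℂ :=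
  ∑ i : Fin (2 * ℓ + 1),
    (Polynomial.C (θ i * (starRingEnd ℂ) (z i)) * Polynomial.X ^ (2 * ℓ - i : ℕ) +
      Polynomial.C ((starRingEnd ℂ) (θ i) * z i) * Polynomial.X ^ (i : ℕ))

lemma natDegree_rotPoly_le (ℓ : ℕ) (θ z : Fin (2 * ℓ + 1) → ℂ) :
    (rotPoly ℓ θ z).natDegree ≤ 2 * ℓ := by
  refine Polynomial.natDegree_sum_le_of_forall_le _ _ fun i _ =>
    Polynomial.natDegree_add_le_of_degree_le ?_ ?_
  · exact (Polynomial.natDegree_C_mul_X_pow_le _ _).trans (by omega)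
  · exact (Polynomial.natDegree_C_mul_X_pow_le _ _).trans (by omega)

lemma exp_pow_mul_rotPairing (ℓ : ℕ) (θ z : Fin (2 * ℓ + 1) → ℂ) (φ : ℝ) :
    Complex.exp (2 * π * Complex.I * φ) ^ ℓ * rotPairing ℓ θ z φ =
      (rotPoly ℓ θ z).eval (Complex.exp (2 * π * Complex.I * φ)) := by
  have h1 (i : Fin (2 * ℓ + 1)) : Complex.exp (2 * π * Complex.I * φ) ^ ℓ * rot ℓ θ φ i =
      θ i * Complex.exp (2 * π * Complex.I * φ) ^ (2 * ℓ - i : ℕ) := by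
    unfold rot
    rw [mul_left_comm, ← Complex.exp_nat_mul, ← Complex.exp_nat_mul, ← Complex.exp_add,
      Nat.cast_sub (by omega)]
    congr 2
    push_cast
    ring
  have h2 (i : Fin (2 * ℓ + 1)) :
      Complex.exp (2 * π * Complex.I * φ) ^ ℓ * (starRingEnd ℂ) (rot ℓ θ φ i) =
      (starRingEnd ℂ) (θ i) * Complex.exp (2 * π * Complex.I * φ) ^ (i : ℕ) := by
    unfold rot
    rw [map_mul, ← Complex.exp_conj, mul_left_comm, ← Complex.exp_nat_mul, ← Complex.exp_nat_mul,
      ← Complex.exp_add]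
    congr 2
    simp only [map_mul, map_neg, Complex.conj_I, Complex.conj_ofReal, map_ofNat]
    push_cast
    ring
  simp only [rotPairing, rotPoly, Polynomial.eval_finsetSum, Complex.ofReal_mul,
    Complex.ofReal_sum, Finset.mul_sum]
  refine Finset.sum_congr rfl fun i _ => ?_
  have h3 := Complex.add_conj (rot ℓ θ φ i * (starRingEnd ℂ) (z i))
  simp only [map_mul, Complex.conj_conj] at h3
  simp only [Polynomial.eval_add, Polynomial.eval_mul, Polynomial.eval_C, Polynomial.eval_pow,
    Polynomial.eval_X]
  push_cast at h3 ⊢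
  linear_combination (starRingEnd ℂ) (z i) * h1 i + z i * h2 i -
    Complex.exp (2 * π * Complex.I * φ) ^ ℓ * h3

lemma sum_mul_rotPairing_pow {ι : Type*} [Fintype ι] {ℓ J : ℕ} {ν φ : ι → ℝ}
    (h : ∑ i, ν i • trigMoment (J * ℓ) (φ i) = 0) (θ z : Fin (2 * ℓ + 1) → ℂ) {j : ℕ}
    (hj : j ≤ J) : ∑ i, ν i * rotPairing ℓ θ z (φ i) ^ j = 0 := by
  obtain ⟨k, rfl⟩ := Nat.exists_eq_add_of_le hj
  have h1 := sum_mul_eval_eq_zero h (Polynomial.X ^ (k * ℓ) * rotPoly ℓ θ z ^ j) (by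
    refine Polynomial.natDegree_mul_le.trans ?_
    have h1 := Polynomial.natDegree_pow_le (p := rotPoly ℓ θ z) (n := j)
    have h2 := Nat.mul_le_mul_left j (natDegree_rotPoly_le ℓ θ z)
    rw [Polynomial.natDegree_X_pow]
    nlinarith)
  have h2 : ((∑ i, ν i * rotPairing ℓ θ z (φ i) ^ j : ℝ) : ℂ) = 0 := by
    rw [← h1]
    push_cast
    refine Finset.sum_congr rfl fun i _ => ?_
    have hu := Complex.exp_ne_zero (2 * π * Complex.I * φ i)
    rw [Polynomial.eval_mul, Polynomial.eval_pow, Polynomial.eval_pow, Polynomial.eval_X,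
      ← exp_pow_mul_rotPairing, inv_pow, mul_pow, ← pow_mul, ← mul_assoc (_ ^ (k * ℓ)), ← pow_add,
      inv_mul_eq_div]
    rw [show k * ℓ + ℓ * j = (j + k) * ℓ by ring, mul_div_cancel_left₀ _ (pow_ne_zero _ hu)]
  exact_mod_cast h2

lemma integral_abs_sum_cgauss_le {ι : Type*} [Fintype ι] {ℓ J : ℕ} {ν φ : ι → ℝ}
    (h : ∑ i, ν i • trigMoment (J * ℓ) (φ i) = 0) (θ : Fin (2 * ℓ + 1) → ℂ) {s : ℝ} (hs : 1 ≤ s) :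
    ∫ z, |∑ i, ν i * cgauss (2 * ℓ + 1) (rot ℓ θ (φ i)) z| ≤
      (∑ i, |ν i|) * (2 * (s ^ J)⁻¹ * rexp ((s ^ 2 - 1) * sqnorm (2 * ℓ + 1) θ)) := by
  have hi := integrable_cgauss (2 * ℓ + 1)
  have hG (i : ι) (z : Fin (2 * ℓ + 1) → ℂ) : cgauss (2 * ℓ + 1) (rot ℓ θ (φ i)) z =
      rexp (-sqnorm (2 * ℓ + 1) θ) * ((π ^ (2 * ℓ + 1))⁻¹ * rexp (-sqnorm (2 * ℓ + 1) z) *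
        rexp (rotPairing ℓ θ z (φ i))) := by
    have := exp_mul_cgauss_zero (2 * ℓ + 1) (rot ℓ θ (φ i)) z 1
    rw [sqnorm_rot] at this
    simp only [one_mul, one_pow, Complex.ofReal_one, one_smul] at this
    rw [mul_assoc (π ^ (2 * ℓ + 1))⁻¹, ← Real.exp_add, rotPairing, this, ← mul_assoc, ← Real.exp_add]
    simp
  have hpt (z : Fin (2 * ℓ + 1) → ℂ) : |∑ i, ν i * cgauss (2 * ℓ + 1) (rot ℓ θ (φ i)) z| ≤
      ∑ i, |ν i| * ((s ^ J)⁻¹ * rexp ((s ^ 2 - 1) * sqnorm (2 * ℓ + 1) θ)) *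
        (cgauss (2 * ℓ + 1) ((s : ℂ) • rot ℓ θ (φ i)) z +
          cgauss (2 * ℓ + 1) (((-s : ℝ) : ℂ) • rot ℓ θ (φ i)) z) := by
    have e1 : ∑ i, ν i * cgauss (2 * ℓ + 1) (rot ℓ θ (φ i)) z =
        rexp (-sqnorm (2 * ℓ + 1) θ) * ((π ^ (2 * ℓ + 1))⁻¹ *
        rexp (-sqnorm (2 * ℓ + 1) z)) * ∑ i, ν i * (rexp (rotPairing ℓ θ z (φ i)) -
          ∑ j ∈ Finset.range J, rotPairing ℓ θ z (φ i) ^ j / j.factorial) := by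
      have : ∑ i, ν i * ∑ j ∈ Finset.range J, rotPairing ℓ θ z (φ i) ^ j / j.factorial = 0 := by
        simp_rw [Finset.mul_sum]
        rw [Finset.sum_comm]
        refine Finset.sum_eq_zero fun j hj => ?_
        simp_rw [← mul_div_assoc]
        rw [← Finset.sum_div, sum_mul_rotPairing_pow h θ z (Finset.mem_range.1 hj).le, zero_div]
      simp_rw [mul_sub]
      rw [Finset.sum_sub_distrib, this, sub_zero, Finset.mul_sum]
      exact Finset.sum_congr rfl fun i _ => by rw [hG]; ring
    rw [e1, Finset.mul_sum]
    refine (Finset.abs_sum_le_sum_abs _ _).trans (Finset.sum_le_sum fun i _ => ?_)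
    rw [abs_mul, abs_mul (ν i), abs_of_nonneg (by positivity)]
    refine (mul_le_mul_of_nonneg_left (mul_le_mul_of_nonneg_left
      (Real.abs_exp_sub_sum_le hs J (rotPairing ℓ θ z (φ i))) (abs_nonneg _))
      (by positivity)).trans_eq ?_
    have e2 := exp_mul_cgauss_zero (2 * ℓ + 1) (rot ℓ θ (φ i)) z s
    have e3 := exp_mul_cgauss_zero (2 * ℓ + 1) (rot ℓ θ (φ i)) z (-s)
    rw [sqnorm_rot, ← rotPairing, Real.exp_add] at e2 e3
    rw [neg_sq] at e3
    rw [show (s ^ 2 - 1) * sqnorm (2 * ℓ + 1) θ =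
      -sqnorm (2 * ℓ + 1) θ + s ^ 2 * sqnorm (2 * ℓ + 1) θ by ring, Real.exp_add]
    linear_combination rexp (-sqnorm (2 * ℓ + 1) θ) * |ν i| * (s ^ J)⁻¹ * (e2 + e3)
  have h_int (i : ι) : Integrable fun z =>
      |ν i| * ((s ^ J)⁻¹ * rexp ((s ^ 2 - 1) * sqnorm (2 * ℓ + 1) θ)) *
        (cgauss (2 * ℓ + 1) ((s : ℂ) • rot ℓ θ (φ i)) z +
          cgauss (2 * ℓ + 1) (((-s : ℝ) : ℂ) • rot ℓ θ (φ i)) z) :=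
    ((hi _).add (hi _)).const_mul _
  refine (integral_mono (integrable_finsetSum _ fun i _ => (hi _).const_mul _).abs
    (integrable_finsetSum _ fun i _ => h_int i) hpt).trans_eq ?_
  rw [integral_finsetSum _ fun i _ => h_int i, Finset.sum_mul]
  refine Finset.sum_congr rfl fun i _ => ?_
  rw [integral_const_mul, integral_add (hi _) (hi _), integral_cgauss, integral_cgauss]
  ring

lemma integral_abs_mixture_sub_le {p : ℕ} (g : Measure ℝ) [IsProbabilityMeasure g]
    {μ ν : ℝ → Fin p → ℂ} (hμ : Measurable μ) (hν : Measurable ν) {η : ℝ}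
    (h : ∀ᵐ φ ∂g, ∫ z, |cgauss p (μ φ) z - cgauss p (ν φ) z| ≤ η) :
    Integrable (fun z => ∫ φ, cgauss p (μ φ) z ∂g) ∧
    (∫ z, ∫ φ, cgauss p (μ φ) z ∂g) = 1 ∧
    ∫ z, |(∫ φ, cgauss p (μ φ) z ∂g) - ∫ φ, cgauss p (ν φ) z ∂g| ≤ η := by
  have key (ξ : ℝ → Fin p → ℂ) (hξ : Measurable ξ) :
      Integrable (fun x : (Fin p → ℂ) × ℝ => cgauss p (ξ x.2) x.1) (volume.prod g) := by
    have hm : Measurable (fun x : (Fin p → ℂ) × ℝ => cgauss p (ξ x.2) x.1) := by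
      have := (measurable_cgauss_uncurry p).comp
        ((hξ.comp (measurable_snd (α := Fin p → ℂ))).prodMk measurable_fst)
      simpa only [Function.comp_def] using this
    refine (integrable_prod_iff' hm.aestronglyMeasurable).2
      ⟨.of_forall fun φ => integrable_cgauss p (ξ φ), ?_⟩
    simp_rw [Real.norm_eq_abs, abs_of_nonneg (cgauss_nonneg _ _ _), integral_cgauss]
    exact integrable_const _
  have hμi := key μ hμ
  have hνi := key ν hν
  refine ⟨hμi.integral_prod_left, ?_, ?_⟩
  · rw [integral_integral_swap hμi]
    simp [integral_cgauss]
  have hd := hμi.sub hνi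
  calc ∫ z, |(∫ φ, cgauss p (μ φ) z ∂g) - ∫ φ, cgauss p (ν φ) z ∂g|
      ≤ ∫ z, ∫ φ, |cgauss p (μ φ) z - cgauss p (ν φ) z| ∂g := by
        refine integral_mono_ae (hμi.integral_prod_left.sub hνi.integral_prod_left).abs
          hd.abs.integral_prod_left ?_
        filter_upwards [hμi.prod_right_ae, hνi.prod_right_ae] with z h1 h2
        rw [← integral_sub h1 h2]
        exact abs_integral_le_integral_abs
    _ = ∫ φ, (∫ z, |cgauss p (μ φ) z - cgauss p (ν φ) z|) ∂g := integral_integral_swap hd.abs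
    _ ≤ ∫ _, η ∂g := integral_mono_ae hd.abs.integral_prod_right (integrable_const _) h
    _ = η := by simp

lemma exists_sparse_combination {E ι : Type*} [AddCommGroup E] [Module ℝ E]
    [FiniteDimensional ℝ E] [Fintype ι] (v : ι → E) (w : ι → ℝ) (hw : ∀ i, 0 ≤ w i)
    (hw1 : ∑ i, w i = 1) {m : ℕ} (hm : Module.finrank ℝ E + 1 ≤ m) :
    ∃ (f : Fin m → ι) (w' : Fin m → ℝ), (∀ i, 0 ≤ w' i) ∧ ∑ i, w' i = 1 ∧
      ∑ i, w' i • v (f i) = ∑ i, w i • v i := by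
  have hx : ∑ i, w i • v i ∈ convexHull ℝ (Set.range v) :=
    (convex_convexHull ℝ _).sum_mem (fun i _ => hw i) hw1
      fun i _ => subset_convexHull ℝ _ (Set.mem_range_self i)
  obtain ⟨κ, _, z, u, hz, hind, hu, hu1, hux⟩ := eq_pos_convex_span_of_mem_convexHull hx
  choose c hc using fun i => hz (Set.mem_range_self i)
  have hcard : Fintype.card κ ≤ Fintype.card (Fin m) := by
    rw [Fintype.card_fin]
    exact (hind.card_le_finrank_succ.trans (by gcongr; exact Submodule.finrank_le _)).trans hm
  obtain ⟨e⟩ := Function.Embedding.nonempty_of_card_le hcard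
  obtain ⟨i₀⟩ : Nonempty ι := by
    by_contra hne
    rw [not_nonempty_iff] at hne
    simp at hw1
  have hext (i : κ) : Function.extend e u 0 (e i) = u i := e.injective.extend_apply _ _ _
  have hext0 (j : Fin m) (hj : j ∉ Set.range e) : Function.extend e u 0 j = 0 :=
    Function.extend_apply' _ _ _ hj
  refine ⟨Function.extend e c fun _ => i₀, Function.extend e u 0, fun j => ?_, ?_, ?_⟩
  · by_cases hj : j ∈ Set.range e
    · obtain ⟨i, rfl⟩ := hj
      rw [hext]
      exact (hu i).le
    · rw [hext0 j hj]
  · rw [← hu1]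
    exact (Fintype.sum_of_injective e e.injective _ _ hext0 fun i => (hext i).symm).symm
  · rw [← hux]
    refine (Fintype.sum_of_injective e e.injective _ _ (fun j hj => ?_) fun i => ?_).symm
    · rw [hext0 j hj, zero_smul]
    · rw [hext, e.injective.extend_apply, hc]

lemma exists_sym_close {m K : ℕ} (hK : 0 < K) (w : Fin m → ℝ) (hw : ∀ i, 0 ≤ w i)
    (hw1 : ∑ i, w i = 1) :
    ∃ s : Sym (Fin m) K, ∑ i, |w i - (s : Multiset (Fin m)).count i / K| ≤ 2 * m / K := by
  have hK' : (0 : ℝ) < K := by exact_mod_cast hK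
  obtain ⟨i₀⟩ : Nonempty (Fin m) := by
    by_contra hne
    rw [not_nonempty_iff] at hne
    simp at hw1
  have hfl (i : Fin m) := Nat.floor_le (mul_nonneg hK'.le (hw i))
  have hsum : ∑ i, ⌊K * w i⌋₊ ≤ K := by
    have : ∑ i, (⌊K * w i⌋₊ : ℝ) ≤ ∑ i, K * w i := Finset.sum_le_sum fun i _ => hfl i
    rw [← Finset.mul_sum, hw1, mul_one] at this
    exact_mod_cast this
  obtain ⟨r, hr⟩ := Nat.exists_eq_add_of_le hsum
  have hr' : (K : ℝ) = ∑ i, (⌊K * w i⌋₊ : ℝ) + r := by exact_mod_cast hr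
  have hrm : (r : ℝ) ≤ m := by
    have : ∑ i, K * w i ≤ ∑ i, ((⌊K * w i⌋₊ : ℝ) + 1) :=
      Finset.sum_le_sum fun i _ => (Nat.lt_floor_add_one _).le
    rw [← Finset.mul_sum, hw1, mul_one, Finset.sum_add_distrib] at this
    simp only [Finset.sum_const, Finset.card_univ, Fintype.card_fin, nsmul_eq_mul, mul_one] at this
    linarith
  let k : Fin m → ℕ := fun i => ⌊K * w i⌋₊ + if i = i₀ then r else 0
  have hk : ∑ i, k i = K := by
    simp only [k, Finset.sum_add_distrib, Finset.sum_ite_eq', Finset.mem_univ, if_true]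
    exact hr.symm
  refine ⟨⟨∑ i, k i • {i}, by simpa using hk⟩, ?_⟩
  have hcount (i : Fin m) : (∑ j, k j • ({j} : Multiset (Fin m))).count i = k i := by
    rw [Multiset.count_sum']
    simp [Multiset.count_singleton]
  simp only [Sym.coe_mk, hcount]
  calc ∑ i, |w i - k i / K|
      ≤ ∑ i, ((K * w i - ⌊K * w i⌋₊) / K + (if i = i₀ then (r : ℝ) else 0) / K) := by
        refine Finset.sum_le_sum fun i _ => ?_
        have : w i - k i / K =
            (K * w i - ⌊K * w i⌋₊) / K - (if i = i₀ then (r : ℝ) else 0) / K := by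
          simp only [k]
          push_cast
          field_simp
          ring
        rw [this]
        refine (abs_sub _ _).trans_eq ?_
        rw [abs_of_nonneg (div_nonneg (sub_nonneg.2 (hfl i)) hK'.le), abs_of_nonneg]
        split_ifs <;> positivity
    _ = 2 * r / K := by
        rw [Finset.sum_add_distrib, ← Finset.sum_div, ← Finset.sum_div, Finset.sum_sub_distrib,
          ← Finset.mul_sum, hw1]
        simp only [Finset.sum_ite_eq', Finset.mem_univ, if_true]
        rw [← add_div]
        congr 1
        linarith
    _ ≤ 2 * m / K := by gcongr

lemma card_sym_le {m K : ℕ} (hm : 0 < m) {η : ℝ} (hη : 0 < η) (hη1 : η ≤ 1) (hK : K ≤ m / η + 1) :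
    (Fintype.card (Sym (Fin m) K) : ℝ) ≤ (3 * rexp 1 / η) ^ m := by
  rw [Sym.card_sym_eq_choose, Fintype.card_fin]
  have hm' : (1 : ℝ) ≤ m := by exact_mod_cast hm
  calc ((m + K - 1).choose K : ℝ) ≤ ((m + K).choose m : ℕ) := by
        rw [Nat.choose_symm_add]
        exact_mod_cast Nat.choose_le_choose K (by omega)
    _ ≤ ((m + K : ℕ) : ℝ) ^ m / m.factorial := Nat.choose_le_pow_div _ _
    _ ≤ (3 * m / η) ^ m / m.factorial := by
        gcongr
        push_cast
        have h1 : (m : ℝ) ≤ m / η := le_div_self (by positivity) hη hη1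
        have h2 : 3 * (m : ℝ) / η = 3 * (m / η) := by ring
        linarith
    _ = (3 / η) ^ m * (m ^ m / m.factorial) := by
        rw [← mul_div_assoc, ← mul_pow]; congr 2; ring
    _ ≤ (3 / η) ^ m * rexp m := by
        gcongr
        exact Real.pow_div_factorial_le_exp _ (Nat.cast_nonneg _) _
    _ = (3 * rexp 1 / η) ^ m := by
        rw [← Real.exp_one_pow, ← mul_pow]; congr 1; ring

lemma dTV_withDensity_le {X : Type*} [MeasurableSpace X] {μ : Measure X} {p q : X → ℝ}
    (hp : Integrable p μ) (hq : Integrable q μ) (hp0 : 0 ≤ p) (hq0 : 0 ≤ q) :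
    dTV (μ.withDensity fun z => ENNReal.ofReal (p z)) (μ.withDensity fun z => ENNReal.ofReal (q z))
      ≤ ∫ z, |p z - q z| ∂μ := by
  have key {f : X → ℝ} (hf : Integrable f μ) (hf0 : 0 ≤ f) {A : Set X} (hA : MeasurableSet A) :
      (μ.withDensity (fun z => ENNReal.ofReal (f z)) A).toReal = ∫ z in A, f z ∂μ := by
    rw [withDensity_apply _ hA, integral_eq_lintegral_of_nonneg_ae (.of_forall hf0)
      hf.aestronglyMeasurable.restrict]
  have h0 : 0 ≤ ∫ z, |p z - q z| ∂μ := integral_nonneg fun _ => abs_nonneg _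
  refine Real.iSup_le (fun A => Real.iSup_le (fun hA => ?_) h0) h0
  rw [key hp hp0 hA, key hq hq0 hA, ← integral_sub hp.integrableOn hq.integrableOn]
  exact abs_integral_le_integral_abs.trans
    (setIntegral_le_integral (hp.sub hq).abs (.of_forall fun _ => abs_nonneg _))

lemma isProbabilityMeasure_withDensity_ofReal {X : Type*} [MeasurableSpace X] {μ : Measure X}
    {p : X → ℝ} (hp : Integrable p μ) (hp0 : 0 ≤ p) (h1 : ∫ z, p z ∂μ = 1) :
    IsProbabilityMeasure (μ.withDensity fun z => ENNReal.ofReal (p z)) := by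
  refine ⟨?_⟩
  rw [withDensity_apply _ MeasurableSet.univ, Measure.restrict_univ,
    ← ofReal_integral_eq_lintegral_ofReal hp (.of_forall hp0), h1, ENNReal.ofReal_one]

lemma sqnorm_rot_sub_le (ℓ : ℕ) (θ : Fin (2 * ℓ + 1) → ℂ) (φ ψ : ℝ) :
    sqnorm (2 * ℓ + 1) (rot ℓ θ φ - rot ℓ θ ψ) ≤ (2 * π * |φ - ψ| * H1norm ℓ θ) ^ 2 := by
  unfold H1norm
  rw [mul_pow, Real.sq_sqrt (by positivity), sqnorm, Finset.mul_sum]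
  refine Finset.sum_le_sum fun i _ => ?_
  set k : ℤ := (i : ℤ) - ℓ
  have h : (rot ℓ θ φ - rot ℓ θ ψ) i = θ i * Complex.exp (-Complex.I * (2 * π * (k : ℝ) * ψ)) *
      (Complex.exp (Complex.I * ((-(2 * π * k * (φ - ψ)) : ℝ) : ℂ)) - 1) := by
    rw [Pi.sub_apply, rot, rot, mul_sub, mul_assoc (θ i), ← Complex.exp_add, mul_one]
    congr 3
    simp only [k]
    push_cast
    ring
  have h1 : ‖Complex.exp (-Complex.I * (2 * π * (k : ℝ) * ψ))‖ = 1 := by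
    rw [Complex.norm_exp]; simp
  rw [h, norm_mul, norm_mul, h1, mul_one, mul_pow]
  have h2 := Real.norm_exp_I_mul_ofReal_sub_one_le (x := -(2 * π * k * (φ - ψ)))
  calc _ ≤ ‖θ i‖ ^ 2 * ‖-(2 * π * k * (φ - ψ))‖ ^ 2 := by gcongr
    _ = _ := by
      rw [Real.norm_eq_abs, sq_abs, mul_pow _ |φ - ψ|, sq_abs]; ring

/-- The Gaussian mixture density with weights `w` at the rotations of `θ` by `x`. -/
noncomputable def finMixDensity {ι : Type*} [Fintype ι] (ℓ : ℕ) (θ : Fin (2 * ℓ + 1) → ℂ)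
    (w x : ι → ℝ) (z : Fin (2 * ℓ + 1) → ℂ) : ℝ :=
  ∑ i, w i * cgauss (2 * ℓ + 1) (rot ℓ θ (x i)) z

section FinMixDensity

variable {ι : Type*} [Fintype ι] {ℓ : ℕ} {θ : Fin (2 * ℓ + 1) → ℂ} {w w' x : ι → ℝ}

lemma integrable_finMixDensity : Integrable (finMixDensity ℓ θ w x) :=
  integrable_finsetSum _ fun _ _ => (integrable_cgauss _ _).const_mul _

lemma integral_finMixDensity : ∫ z, finMixDensity ℓ θ w x z = ∑ i, w i := by
  unfold finMixDensity
  rw [integral_finsetSum _ fun _ _ => (integrable_cgauss _ _).const_mul _]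
  simp_rw [integral_const_mul, integral_cgauss, mul_one]

lemma finMixDensity_nonneg (hw : ∀ i, 0 ≤ w i) : 0 ≤ finMixDensity ℓ θ w x := fun _ =>
  Finset.sum_nonneg fun i _ => mul_nonneg (hw i) (cgauss_nonneg _ _ _)

lemma integral_abs_finMixDensity_sub_le :
    ∫ z, |finMixDensity ℓ θ w x z - finMixDensity ℓ θ w' x z| ≤ ∑ i, |w i - w' i| := by
  rw [← integral_finMixDensity (ℓ := ℓ) (θ := θ) (x := x)]
  refine integral_mono (integrable_finMixDensity.sub integrable_finMixDensity).abs
    integrable_finMixDensity fun z => ?_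
  simp only [finMixDensity, ← Finset.sum_sub_distrib, ← sub_mul]
  refine (Finset.abs_sum_le_sum_abs _ _).trans_eq (Finset.sum_congr rfl fun i _ => ?_)
  rw [abs_mul, abs_of_nonneg (cgauss_nonneg _ _ _)]

lemma exists_sparse_finMixDensity (hw : ∀ i, 0 ≤ w i) (hw1 : ∑ i, w i = 1) {J m : ℕ}
    (hm : 4 * (J * ℓ) + 3 ≤ m) {s : ℝ} (hs : 1 ≤ s) :
    ∃ (f : Fin m → ι) (u : Fin m → ℝ), (∀ i, 0 ≤ u i) ∧ ∑ i, u i = 1 ∧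
      ∫ z, |finMixDensity ℓ θ w x z - finMixDensity ℓ θ u (x ∘ f) z| ≤
        4 * (s ^ J)⁻¹ * rexp ((s ^ 2 - 1) * sqnorm (2 * ℓ + 1) θ) := by
  have hfin : Module.finrank ℝ (Fin (2 * (J * ℓ) + 1) → ℂ) + 1 ≤ m := by
    rw [Module.finrank_pi_fintype]
    simp only [Complex.finrank_real_complex, Finset.sum_const, Finset.card_univ, Fintype.card_fin,
      smul_eq_mul]
    omega
  obtain ⟨f, u, hu, hu1, hfu⟩ :=
    exists_sparse_combination (fun i => trigMoment (J * ℓ) (x i)) w hw hw1 hfin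
  refine ⟨f, u, hu, hu1, ?_⟩
  have h := integral_abs_sum_cgauss_le (ι := ι ⊕ Fin m) (ν := Sum.elim w (-u))
    (φ := Sum.elim x (x ∘ f)) (J := J) (by
      simp only [Fintype.sum_sum_type, Sum.elim_inl, Sum.elim_inr, Pi.neg_apply, neg_smul,
        Finset.sum_neg_distrib, Function.comp_apply]
      rw [hfu, add_neg_cancel]) θ hs
  simp only [Fintype.sum_sum_type, Sum.elim_inl, Sum.elim_inr, Pi.neg_apply, neg_mul,
    Finset.sum_neg_distrib, abs_neg, abs_of_nonneg (hw _), abs_of_nonneg (hu _), hw1, hu1,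
    ← sub_eq_add_neg] at h
  exact h.trans_eq (by ring)

end FinMixDensity

lemma measurable_rot (ℓ : ℕ) (θ : Fin (2 * ℓ + 1) → ℂ) : Measurable (rot ℓ θ) := by
  refine Continuous.measurable ?_
  unfold rot
  fun_prop

lemma exists_grid_finMixDensity {ℓ M : ℕ} {θ : Fin (2 * ℓ + 1) → ℂ} {η : ℝ} (hη : 0 < η)
    (hη1 : η ≤ 1) (hM : 0 < M) (hMη : 2 * π * H1norm ℓ θ / M ≤ η / 4) {g : Measure ℝ}
    (hg : IsProbOn01 g) :
    ∃ w : Fin (M + 1) → ℝ, (∀ j, 0 ≤ w j) ∧ ∑ j, w j = 1 ∧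
      ∫ z, |mixDensity ℓ θ g z - finMixDensity ℓ θ w (fun j => (j : ℝ) / M) z| ≤ η := by
  obtain ⟨_, hg1⟩ := hg
  have hM' : (0 : ℝ) < M := by exact_mod_cast hM
  let r : ℝ → Fin (M + 1) := fun φ => ⟨min ⌊φ * M⌋₊ M, by omega⟩
  have hr : Measurable r := by
    have h1 : Measurable fun φ : ℝ => min ⌊φ * M⌋₊ M :=
      (Nat.measurable_floor.comp (measurable_id.mul_const _)).min measurable_const
    refine measurable_to_countable' fun j => ?_
    have : r ⁻¹' {j} = (fun φ : ℝ => min ⌊φ * M⌋₊ M) ⁻¹' {(j : ℕ)} := by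
      ext φ
      simp [r, Fin.ext_iff]
    rw [this]
    exact h1 (measurableSet_singleton _)
  have hgrid (φ : ℝ) (hφ : φ ∈ Set.Icc (0 : ℝ) 1) : |φ - (r φ : ℝ) / M| ≤ 1 / M := by
    have h0 : 0 ≤ φ * M := mul_nonneg hφ.1 hM'.le
    have h1 : ⌊φ * M⌋₊ ≤ M :=
      Nat.floor_le_of_le (mul_le_of_le_one_left hM'.le hφ.2)
    have h2 : (r φ : ℕ) = ⌊φ * M⌋₊ := min_eq_left h1
    rw [h2, show φ - (⌊φ * M⌋₊ : ℝ) / M = (φ * M - ⌊φ * M⌋₊) / M by field_simp, abs_div,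
      abs_of_pos hM']
    gcongr
    rw [abs_of_nonneg (sub_nonneg.2 (Nat.floor_le h0))]
    linarith [Nat.lt_floor_add_one (φ * M)]
  have : IsProbabilityMeasure (g.map r) := Measure.isProbabilityMeasure_map hr.aemeasurable
  refine ⟨fun j => (g.map r).real {j}, fun j => measureReal_nonneg, ?_, ?_⟩
  · simp
  have hmix (z : Fin (2 * ℓ + 1) → ℂ) :
      finMixDensity ℓ θ (fun j => (g.map r).real {j}) (fun j => (j : ℝ) / M) z =
        ∫ φ, cgauss (2 * ℓ + 1) (rot ℓ θ ((r φ : ℝ) / M)) z ∂g := by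
    rw [← integral_map (f := fun j : Fin (M + 1) => cgauss (2 * ℓ + 1) (rot ℓ θ ((j : ℝ) / M)) z)
      hr.aemeasurable .of_discrete, integral_fintype .of_finite]
    rfl
  simp_rw [hmix]
  refine (integral_abs_mixture_sub_le g (measurable_rot ℓ θ)
    (ν := fun φ => rot ℓ θ ((r φ : ℝ) / M)) ?_ ?_).2.2
  · exact (Measurable.of_discrete (f := fun j : Fin (M + 1) => rot ℓ θ ((j : ℝ) / M))).comp hr
  · have hae : ∀ᵐ φ ∂g, φ ∈ Set.Icc (0 : ℝ) 1 :=
      (prob_compl_eq_zero_iff measurableSet_Icc).2 hg1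
    filter_upwards [hae] with φ hφ
    refine integral_abs_cgauss_sub_le _ _ _ hη hη1 ((sqnorm_rot_sub_le ℓ θ _ _).trans ?_)
    have hH : 0 ≤ H1norm ℓ θ := Real.sqrt_nonneg _
    calc (2 * π * |φ - (r φ : ℝ) / M| * H1norm ℓ θ) ^ 2
        ≤ (2 * π * (1 / M) * H1norm ℓ θ) ^ 2 := by
          gcongr
          exact hgrid φ hφ
      _ = (2 * π * H1norm ℓ θ / M) ^ 2 := by ring
      _ ≤ (η / 4) ^ 2 := by gcongr
      _ = η ^ 2 / 16 := by ring

lemma integrable_mixDensity (ℓ : ℕ) (θ : Fin (2 * ℓ + 1) → ℂ) (g : Measure ℝ)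
    [IsProbabilityMeasure g] : Integrable (mixDensity ℓ θ g) :=
  (integral_abs_mixture_sub_le g (η := 0) (measurable_rot ℓ θ) (measurable_rot ℓ θ)
    (.of_forall fun _ => by simp)).1

lemma mixDensity_nonneg (ℓ : ℕ) (θ : Fin (2 * ℓ + 1) → ℂ) (g : Measure ℝ) :
    0 ≤ mixDensity ℓ θ g := fun _ => integral_nonneg fun _ => cgauss_nonneg _ _ _

lemma integral_abs_sub_le_add {X : Type*} [MeasurableSpace X] {μ : Measure X} {f g h : X → ℝ}
    (hf : Integrable f μ) (hg : Integrable g μ) (hh : Integrable h μ) :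
    ∫ x, |f x - h x| ∂μ ≤ ∫ x, |f x - g x| ∂μ + ∫ x, |g x - h x| ∂μ := by
  have h1 : Integrable (fun x => |f x - g x|) μ := (hf.sub hg).abs
  have h2 : Integrable (fun x => |g x - h x|) μ := (hg.sub hh).abs
  rw [← integral_add h1 h2]
  exact integral_mono (hf.sub hh).abs (h1.add h2) fun x => abs_sub_le _ _ _

/-- Covering by mixtures of `m` Gaussians with weights in `K⁻¹ℕ` at grid rotations. -/
lemma exists_covering {ℓ M J m K : ℕ} {θ : Fin (2 * ℓ + 1) → ℂ} {η s : ℝ} (hη : 0 < η)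
    (hη1 : η ≤ 1) (hM : 0 < M) (hMη : 2 * π * H1norm ℓ θ / M ≤ η / 4)
    (hm : 4 * (J * ℓ) + 3 ≤ m) (hs : 1 ≤ s) (hK : 0 < K) {g : Measure ℝ} (hg : IsProbOn01 g) :
    ∃ c : (Fin m → Fin (M + 1)) × Sym (Fin m) K,
      ∫ z, |mixDensity ℓ θ g z - finMixDensity ℓ θ
          (fun i => ((c.2 : Multiset (Fin m)).count i : ℝ) / K) (fun i => (c.1 i : ℝ) / M) z| ≤
        η + 4 * (s ^ J)⁻¹ * rexp ((s ^ 2 - 1) * sqnorm (2 * ℓ + 1) θ) + 2 * m / K := by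
  obtain ⟨w, hw, hw1, h1⟩ := exists_grid_finMixDensity hη hη1 hM hMη hg
  obtain ⟨f, u, hu, hu1, h2⟩ := exists_sparse_finMixDensity (θ := θ)
    (x := fun j : Fin (M + 1) => (j : ℝ) / M) hw hw1 hm hs
  obtain ⟨c, hc⟩ := exists_sym_close hK u hu hu1
  refine ⟨(f, c), ?_⟩
  have h3 := (integral_abs_finMixDensity_sub_le (θ := θ)
    (x := (fun j : Fin (M + 1) => (j : ℝ) / M) ∘ f)).trans hc
  have := hg.1
  have i0 := integrable_mixDensity ℓ θ g
  have i1 : Integrable (finMixDensity ℓ θ w fun j => (j : ℝ) / M) := integrable_finMixDensity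
  have i2 : Integrable (finMixDensity ℓ θ u ((fun j : Fin (M + 1) => (j : ℝ) / M) ∘ f)) :=
    integrable_finMixDensity
  have i3 : Integrable (finMixDensity ℓ θ (fun i => ((c : Multiset (Fin m)).count i : ℝ) / K)
    ((fun j : Fin (M + 1) => (j : ℝ) / M) ∘ f)) := integrable_finMixDensity
  exact (integral_abs_sub_le_add i0 i1 i3).trans ((add_le_add h1
    ((integral_abs_sub_le_add i1 i2 i3).trans (add_le_add h2 h3))).trans_eq (by ring))

lemma truncation_error_le {a b S ε : ℝ} {ℓ c : ℕ} (hℓ : 1 ≤ ℓ) (ha : 0 < a) (hε : 0 < ε)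
    (hbℓ : Real.log (1 / ε) ≤ b * ℓ) (hS : S ≤ a * (2 * (ℓ : ℝ) + 1)) (hc : 21 * a + b + 3 ≤ c) :
    4 * (rexp 1 ^ (c * ℓ))⁻¹ * rexp ((rexp 1 ^ 2 - 1) * S) ≤ ε / 2 := by
  have hℓ' : (1 : ℝ) ≤ ℓ := by exact_mod_cast hℓ
  have he := Real.exp_one_lt_d9
  have he' := Real.exp_one_gt_d9
  have h1 : (rexp 1 ^ 2 - 1) * S ≤ 7 * (a * (3 * ℓ)) := by
    have h3 : S ≤ a * (3 * ℓ) := hS.trans (by gcongr; linarith)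
    have h4 : 0 ≤ rexp 1 ^ 2 - 1 := by nlinarith
    have h5 : rexp 1 ^ 2 - 1 ≤ 7 := by nlinarith
    exact (mul_le_mul_of_nonneg_left h3 h4).trans (by gcongr)
  have h2 : -((c * ℓ : ℕ) : ℝ) + 7 * (a * (3 * ℓ)) ≤ -3 + Real.log ε := by
    rw [one_div, Real.log_inv] at hbℓ
    push_cast
    nlinarith
  have h3 : 8 ≤ rexp 3 := by
    rw [show (3 : ℝ) = ((3 : ℕ) : ℝ) * 1 by norm_num, Real.exp_nat_mul]
    calc (8 : ℝ) = 2 ^ 3 := by norm_num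
      _ ≤ rexp 1 ^ 3 := by gcongr; linarith
  calc 4 * (rexp 1 ^ (c * ℓ))⁻¹ * rexp ((rexp 1 ^ 2 - 1) * S)
      = 4 * rexp (-((c * ℓ : ℕ) : ℝ) + (rexp 1 ^ 2 - 1) * S) := by
        rw [Real.exp_one_pow, ← Real.exp_neg, mul_assoc, ← Real.exp_add]
    _ ≤ 4 * rexp (-3 + Real.log ε) := by gcongr 4 * rexp ?_; linarith
    _ = 4 * ((rexp 3)⁻¹ * ε) := by rw [Real.exp_add, Real.exp_log hε, Real.exp_neg]
    _ ≤ 4 * (8⁻¹ * ε) := by gcongr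
    _ = ε / 2 := by ring

lemma log_card_covering_le {M m K : ℕ} {ε H : ℝ} (hε : 0 < ε) (hε1 : ε ≤ 1) (hH : 0 ≤ H)
    (hm : 0 < m) (hM : (M : ℝ) ≤ 8 * π * H / (ε / 8) + 2) (hK : (K : ℝ) ≤ m / (ε / 8) + 1) :
    Real.log (Fintype.card ((Fin m → Fin (M + 1)) × Sym (Fin m) K)) ≤
      12 * m * (Real.log (1 / ε) + Real.log (rexp 1 + H)) := by
  have : Nonempty (Sym (Fin m) K) := ⟨Sym.replicate K ⟨0, hm⟩⟩
  have hS : 0 < (Fintype.card (Sym (Fin m) K) : ℝ) := by exact_mod_cast Fintype.card_pos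
  have he := Real.exp_one_gt_d9
  have hM1 : (M : ℝ) + 1 ≤ rexp 6 * (rexp 1 + H) * (1 / ε) := by
    have h6 : 208 ≤ rexp 6 := by
      rw [show (6 : ℝ) = ((6 : ℕ) : ℝ) * 1 by norm_num, Real.exp_nat_mul]
      calc (208 : ℝ) ≤ 2.7 ^ 6 := by norm_num
        _ ≤ rexp 1 ^ 6 := by gcongr; linarith
    have h1 : 3 ≤ 24 * (1 / ε) := by
      have := one_le_one_div hε hε1
      linarith
    have h2 : 8 * π * H / (ε / 8) ≤ 208 * H * (1 / ε) := by
      have h3 : 8 * π * H / (ε / 8) = 64 * π * H * (1 / ε) := by field_simp; ring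
      rw [h3]
      gcongr
      linarith [Real.pi_lt_d2]
    calc (M : ℝ) + 1 ≤ 208 * (rexp 1 + H) * (1 / ε) := by
          have : 24 * (1 / ε) ≤ 208 * rexp 1 * (1 / ε) := by gcongr; linarith
          linarith
      _ ≤ _ := by gcongr
  have hS1 : 3 * rexp 1 / (ε / 8) ≤ rexp 5 * (1 / ε) := by
    have h4 : 24 ≤ rexp 4 := by
      rw [show (4 : ℝ) = ((4 : ℕ) : ℝ) * 1 by norm_num, Real.exp_nat_mul]
      calc (24 : ℝ) ≤ 2.7 ^ 4 := by norm_num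
        _ ≤ rexp 1 ^ 4 := by gcongr; linarith
    rw [show (5 : ℝ) = 4 + 1 by norm_num, Real.exp_add]
    calc 3 * rexp 1 / (ε / 8) = 24 * rexp 1 * (1 / ε) := by field_simp; ring
      _ ≤ _ := by gcongr
  have hLM : Real.log ((M : ℝ) + 1) ≤ 6 + Real.log (rexp 1 + H) + Real.log (1 / ε) := by
    refine (Real.log_le_log (by positivity) hM1).trans_eq ?_
    rw [Real.log_mul (by positivity) (by positivity), Real.log_mul (by positivity) (by positivity),
      Real.log_exp]
  have hLS : Real.log (Fintype.card (Sym (Fin m) K)) ≤ m * (5 + Real.log (1 / ε)) := by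
    refine (Real.log_le_log hS (card_sym_le hm (by positivity) (by linarith) hK)).trans ?_
    rw [Real.log_pow]
    gcongr
    refine (Real.log_le_log (by positivity) hS1).trans_eq ?_
    rw [Real.log_mul (by positivity) (by positivity), Real.log_exp]
  have hLH : 1 ≤ Real.log (rexp 1 + H) := by
    rw [Real.le_log_iff_exp_le (by positivity)]
    linarith
  have hLε : 0 ≤ Real.log (1 / ε) := Real.log_nonneg (one_le_one_div hε hε1)
  rw [Fintype.card_prod, Fintype.card_fun, Fintype.card_fin, Fintype.card_fin]
  push_cast
  rw [Real.log_mul (by positivity) hS.ne', Real.log_pow]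
  calc _ ≤ (m : ℝ) * (6 + Real.log (rexp 1 + H) + Real.log (1 / ε)) +
        m * (5 + Real.log (1 / ε)) := by gcongr
    _ = (m : ℝ) * (11 + Real.log (rexp 1 + H) + 2 * Real.log (1 / ε)) := by ring
    _ ≤ m * (12 * (Real.log (1 / ε) + Real.log (rexp 1 + H))) := by gcongr; linarith
    _ = _ := by ring

/-- total variation ε-covering of {P_{θ,g} : g ∈ 𝔐([0,1])} of log-cardinality
at most C ℓ² (log(1/ε) + log(e+‖θ‖_{H1})), whenever log(1/ε) ≤ bℓ and ‖θ‖² ≤ a(2ℓ+1). -/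
theorem covering_of_Pf_dTV :
    ∀ a b : ℝ, 0 < a → 0 < b →
      ∃ C : ℝ, 0 < C ∧ ∃ ε₀ ∈ Set.Ioo (0 : ℝ) 1, ∀ ε ∈ Set.Ioc (0 : ℝ) ε₀,
        ∀ (ℓ : ℕ), 1 ≤ ℓ → Real.log (1 / ε) ≤ b * ℓ →
          ∀ θ : Fin (2 * ℓ + 1) → ℂ, sqnorm (2 * ℓ + 1) θ ≤ a * (2 * (ℓ : ℝ) + 1) →
            ∃ N : ℕ, 1 ≤ N ∧
              Real.log N ≤ C * (ℓ : ℝ) ^ 2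
                * (Real.log (1 / ε) + Real.log (Real.exp 1 + H1norm ℓ θ)) ∧
              ∃ ctr : Fin N → Measure (Fin (2 * ℓ + 1) → ℂ),
                (∀ i, IsProbabilityMeasure (ctr i)) ∧
                ∀ g : Measure ℝ, IsProbOn01 g →
                  ∃ i, dTV (mixMeasure ℓ θ g) (ctr i) ≤ ε := by
  intro a b ha hb
  set c := ⌈21 * a + b + 3⌉₊
  have hc : 21 * a + b + 3 ≤ c := Nat.le_ceil _
  refine ⟨12 * (4 * c + 3), by positivity, 1 / 2, by norm_num, ?_⟩
  rintro ε ⟨hε, hε2⟩ ℓ hℓ hbℓ θ hθ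
  have hℓ' : (1 : ℝ) ≤ ℓ := by exact_mod_cast hℓ
  have hH : 0 ≤ H1norm ℓ θ := Real.sqrt_nonneg _
  set η := ε / 8 with hη_def
  have hη : 0 < η := by positivity
  have hη1 : η ≤ 1 := by linarith
  set m := 4 * (c * ℓ * ℓ) + 3 with hm_def
  set M := ⌈8 * π * H1norm ℓ θ / η⌉₊ + 1
  set K := ⌈m / η⌉₊
  have hm0 : 0 < m := by omega
  have hm' : (0 : ℝ) < m := by exact_mod_cast hm0
  have hK0 : 0 < K := Nat.ceil_pos.2 (by positivity)
  have hK' : (0 : ℝ) < K := by exact_mod_cast hK0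
  have hM0 : 0 < M := Nat.succ_pos _
  have hM' : (0 : ℝ) < M := by exact_mod_cast hM0
  have hMη : 2 * π * H1norm ℓ θ / M ≤ η / 4 := by
    have h : 8 * π * H1norm ℓ θ / η ≤ M := (Nat.le_ceil _).trans (by simp [M])
    rw [div_le_iff₀ hη] at h
    rw [div_le_iff₀ hM']
    linarith
  have hKη : 2 * m / K ≤ 2 * η := by
    have h : (m : ℝ) / η ≤ K := Nat.le_ceil _
    rw [div_le_iff₀ hη] at h
    rw [div_le_iff₀ hK']
    linarith
  have : Nonempty (Sym (Fin m) K) := ⟨Sym.replicate K ⟨0, hm0⟩⟩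
  let e := Fintype.equivFin ((Fin m → Fin (M + 1)) × Sym (Fin m) K)
  let d (t : (Fin m → Fin (M + 1)) × Sym (Fin m) K) : (Fin (2 * ℓ + 1) → ℂ) → ℝ :=
    finMixDensity ℓ θ (fun i => ((t.2 : Multiset (Fin m)).count i : ℝ) / K)
      (fun i => (t.1 i : ℝ) / M)
  have hd0 (t) : 0 ≤ d t := finMixDensity_nonneg fun i => by positivity
  refine ⟨Fintype.card ((Fin m → Fin (M + 1)) × Sym (Fin m) K), Fintype.card_pos, ?_,
    fun i => volume.withDensity fun z => ENNReal.ofReal (d (e.symm i) z), fun i => ?_,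
    fun g hg => ?_⟩
  · have hM2 : (M : ℝ) ≤ 8 * π * H1norm ℓ θ / η + 2 := by
      have := Nat.ceil_lt_add_one (a := 8 * π * H1norm ℓ θ / η) (by positivity)
      simp only [M]
      push_cast
      linarith
    have hK2 : (K : ℝ) ≤ m / η + 1 := (Nat.ceil_lt_add_one (by positivity)).le
    refine (log_card_covering_le hε (by linarith) hH hm0 hM2 hK2).trans ?_
    have hL : 0 ≤ Real.log (1 / ε) + Real.log (rexp 1 + H1norm ℓ θ) :=
      add_nonneg (Real.log_nonneg (one_le_one_div hε (by linarith)))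
        (Real.log_nonneg (by linarith [Real.add_one_le_exp 1]))
    have hmℓ : (m : ℝ) ≤ (4 * c + 3) * (ℓ : ℝ) ^ 2 := by
      rw [hm_def]
      push_cast
      nlinarith
    refine mul_le_mul_of_nonneg_right ?_ hL
    linarith
  · refine isProbabilityMeasure_withDensity_ofReal integrable_finMixDensity (hd0 _) ?_
    rw [integral_finMixDensity, ← Finset.sum_div, ← Nat.cast_sum,
      Multiset.sum_count_eq_card fun _ _ => Finset.mem_univ _, Sym.card_coe, div_self hK'.ne']
  · obtain ⟨t, ht⟩ := exists_covering (J := c * ℓ) (m := m) (K := K) (s := rexp 1) hη hη1 hM0 hMη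
      le_rfl (by linarith [Real.add_one_le_exp 1]) hK0 hg
    have := hg.1
    refine ⟨e t, ?_⟩
    simp only [e.symm_apply_apply]
    refine (dTV_withDensity_le (integrable_mixDensity ℓ θ g) integrable_finMixDensity
      (mixDensity_nonneg ℓ θ g) (hd0 t)).trans (ht.trans ?_)
    have := truncation_error_le hℓ ha hε hbℓ hθ hc
    linarith
end
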